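/- Let k and k' be algebraically closed fields, let K|k and K'|k' be 1-dimensional function fields, and let F and F' be algebraic closures of K and K' respectively. The map Φ, which sends a field isomorphism σ : F' ≅ F satisfying σ(K') = K and σ(k') = k to the map Φ(σ) : G_{F|k} → G_{F'|k'} defined by Φ(σ)(τ) = σ⁻¹ ∘ τ ∘ σ, is a bijection from the set of such isomorphisms of field towers F'|K'|k' ≅ F|K|k onto the set of isomorphisms of topological groups G_{F|k} ≅ G_{F'|k'} that map U_K onto U_{K'}. -/

import Mathlib

/-- The topology of pointwise convergence on `Aut(F|k)`: the subspace topology induced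
from the product topology on `F → F` with `F` discrete. -/
def autTop (k F : Type*) [Field k] [Field F] [Algebra k F] : TopologicalSpace (F ≃ₐ[k] F) :=
  TopologicalSpace.induced (fun σ => (σ : F → F))
    (@Pi.topologicalSpace F (fun _ => F) (fun _ => ⊥))

/-- Isomorphisms of field towers `F'|K'|k' ≅ F|K|k`: field isomorphisms `σ : F' ≅ F`
with `σ(k') = k` and `σ(K') = K`. -/
def TowerIso (k F k' F' : Type*) [Field k] [Field F] [Field k'] [Field F']
    [Algebra k F] [Algebra k' F']
    (K : IntermediateField k F) (K' : IntermediateField k' F') : Type _ :=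
  {σ : F' ≃+* F //
    σ '' Set.range (algebraMap k' F') = Set.range (algebraMap k F) ∧
    σ '' (K' : Set F') = (K : Set F)}

/-- Isomorphisms of pairs `(G_{F|k}, U_K) ≅ (G_{F'|k'}, U_{K'})`: isomorphisms of
topological groups `G_{F|k} ≅ G_{F'|k'}` mapping `U_K` onto `U_{K'}`. -/
def PairIso (k F k' F' : Type*) [Field k] [Field F] [Field k'] [Field F']
    [Algebra k F] [Algebra k' F']
    (K : IntermediateField k F) (K' : IntermediateField k' F') : Type _ :=
  {e : (F ≃ₐ[k] F) ≃* (F' ≃ₐ[k'] F') //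
    @Continuous _ _ (autTop k F) (autTop k' F') e ∧
    @Continuous _ _ (autTop k' F') (autTop k F) e.symm ∧
    Subgroup.map e.toMonoidHom K.fixingSubgroup = K'.fixingSubgroup}

open Polynomial IntermediateField

section Comap

variable {k F k' F' : Type*} [Field k] [Field F] [Field k'] [Field F'] [Algebra k F] [Algebra k' F']

theorem exists_forall_mem_iff_apply_mem (ψ : F →+* F')
    (h : ∀ a, ψ (algebraMap k F a) ∈ Set.range (algebraMap k' F')) (K' : IntermediateField k' F') :
    ∃ L : IntermediateField k F, ∀ z, z ∈ L ↔ ψ z ∈ K' := by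
  refine ⟨(K'.toSubfield.comap ψ).toIntermediateField fun a => ?_, fun z => Iff.rfl⟩
  obtain ⟨b, hb⟩ := h a
  change ψ (algebraMap k F a) ∈ K'
  rw [← hb]
  exact IntermediateField.algebraMap_mem _ b

end Comap

/-- The field extension `F / k` has transcendence degree one. -/
class TrdegOne (k F : Type*) [Field k] [Field F] [Algebra k F] : Prop where
  exists_transcendental : ∃ x : F, Transcendental k x
  isAlgebraic : ∀ x : F, Transcendental k x → Algebra.IsAlgebraic k⟮x⟯ F

section Basic

variable {k F : Type*} [Field k] [Field F] [Algebra k F]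

theorem TrdegOne.of_isAlgebraic {x : F} (hx : Transcendental k x)
    (h : Algebra.IsAlgebraic k⟮x⟯ F) : TrdegOne k F := by
  refine ⟨⟨x, hx⟩, fun y hy => ?_⟩
  have hx' : AlgebraicIndependent k (fun _ : Unit => x) :=
    (algebraicIndependent_unique_type_iff).2 hx
  have hy' : AlgebraicIndependent k (fun _ : Unit => y) :=
    (algebraicIndependent_unique_type_iff).2 hy
  have hb : IsTranscendenceBasis k (fun _ : Unit => x) := by
    rw [hx'.isTranscendenceBasis_iff_isAlgebraic, Set.range_const]
    exact isAlgebraic_adjoin_iff_top.1 h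
  have hb' : IsTranscendenceBasis k (fun _ : Unit => y) :=
    hy'.isTranscendenceBasis_of_lift_trdeg_le_of_finite hb.lift_cardinalMk_eq_trdeg.ge
  have := hb'.isAlgebraic_field
  rwa [Set.range_const] at this

theorem not_transcendental_iff [IsAlgClosed k] {x : F} :
    ¬ Transcendental k x ↔ ∃ a, algebraMap k F a = x := by
  rw [Transcendental, not_not]
  constructor
  · intro h
    have h1 := IsAlgClosed.degree_eq_one_of_irreducible k (minpoly.irreducible h.isIntegral)
    exact minpoly.mem_range_of_degree_eq_one k x h1
  · rintro ⟨a, rfl⟩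
    exact isAlgebraic_algebraMap a

theorem exists_algEquiv_apply_eq [IsAlgClosed F] [TrdegOne k F] {x y : F}
    (hx : Transcendental k x) (hy : Transcendental k y) : ∃ τ : F ≃ₐ[k] F, τ x = y := by
  have := TrdegOne.isAlgebraic x hx
  have := TrdegOne.isAlgebraic y hy
  have : IsAlgClosure k⟮x⟯ F := ⟨inferInstance, inferInstance⟩
  have : IsAlgClosure k⟮y⟯ F := ⟨inferInstance, inferInstance⟩
  let f : k⟮x⟯ ≃ₐ[k] k⟮y⟯ :=
    (RatFunc.algEquivOfTranscendental x hx).symm.trans (RatFunc.algEquivOfTranscendental y hy)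
  let g : F ≃+* F := IsAlgClosure.equivOfEquiv F F f.toRingEquiv
  have hg : ∀ z : k⟮x⟯, g z = f z := fun z =>
    IsAlgClosure.equivOfEquiv_algebraMap F F f.toRingEquiv z
  refine ⟨AlgEquiv.ofRingEquiv (f := g) fun a => ?_, ?_⟩
  · have := hg (algebraMap k _ a)
    rw [AlgEquiv.commutes] at this
    exact this
  · have h1 := hg (AdjoinSimple.gen k x)
    have h2 : f (AdjoinSimple.gen k x) = AdjoinSimple.gen k y := by
      have hX : ∀ (z : F) (hz : Transcendental k z),
          RatFunc.algEquivOfTranscendental z hz RatFunc.X = AdjoinSimple.gen k z :=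
        fun z hz => Subtype.ext (RatFunc.algEquivOfTranscendental_X z hz)
      rw [← hX x hx]
      simp [f, hX]
    rw [h2] at h1
    exact h1

theorem exists_pow_mem_of_fixed [IsAlgClosed F] (p : ℕ) [ExpChar F p] (E : IntermediateField k F)
    [Algebra.IsAlgebraic E F] {y : F}
    (h : ∀ τ : F ≃ₐ[k] F, (∀ z ∈ E, τ z = z) → τ y = y) : ∃ n : ℕ, y ^ p ^ n ∈ E := by
  classical
  have : ExpChar E p := (algebraMap E F).expChar (algebraMap E F).injective p
  have : IsAlgClosure E F := ⟨inferInstance, inferInstance⟩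
  have : Normal E F := IsAlgClosure.normal E F
  have hy : IsIntegral E y := Algebra.IsIntegral.isIntegral y
  have hmem : y ∈ perfectClosure E F := by
    rw [mem_perfectClosure_iff_natSepDegree_eq_one, natSepDegree_eq_of_isAlgClosed F,
      Finset.card_eq_one]
    refine ⟨y, ?_⟩
    ext z
    rw [Finset.mem_singleton, Multiset.mem_toFinset, mem_aroots]
    constructor
    · rintro ⟨-, hz⟩
      obtain ⟨σ, hσ⟩ := minpoly.exists_algEquiv_of_root' (Algebra.IsAlgebraic.isAlgebraic y) hz
      rw [← hσ]
      exact h (σ.restrictScalars k) fun z hz => σ.commutes ⟨z, hz⟩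
    · rintro rfl
      exact ⟨minpoly.ne_zero hy, minpoly.aeval E z⟩
  obtain ⟨n, a, ha⟩ := (mem_perfectClosure_iff_pow_mem p).1 hmem
  exact ⟨n, ha ▸ a.2⟩

theorem forall_mem_adjoin_apply_eq {x : F} {τ : F ≃ₐ[k] F} (h : τ x = x) :
    ∀ z ∈ k⟮x⟯, τ z = z := by
  intro z hz
  obtain ⟨r, s, rfl⟩ := (mem_adjoin_simple_iff k z).1 hz
  rw [map_div₀, ← aeval_algHom_apply, ← aeval_algHom_apply, h]

theorem exists_pow_mem_adjoin_of_fixed [IsAlgClosed F] [TrdegOne k F] (p : ℕ) [ExpChar F p]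
    {x y : F} (hx : Transcendental k x)
    (h : ∀ τ : F ≃ₐ[k] F, τ x = x → τ y = y) : ∃ n : ℕ, y ^ p ^ n ∈ k⟮x⟯ := by
  have := TrdegOne.isAlgebraic x hx
  exact exists_pow_mem_of_fixed p k⟮x⟯ fun τ hτ => h τ (hτ x (mem_adjoin_simple_self k x))

theorem finite_orbit [TrdegOne k F] {v : F} (hv : Transcendental k v) (y : F) :
    {z | ∃ τ : F ≃ₐ[k] F, τ v = v ∧ τ y = z}.Finite := by
  classical
  have := TrdegOne.isAlgebraic v hv
  have hy : IsIntegral k⟮v⟯ y := Algebra.IsIntegral.isIntegral y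
  refine ((minpoly k⟮v⟯ y).aroots F).toFinset.finite_toSet.subset ?_
  rintro z ⟨τ, hτ, rfl⟩
  rw [Finset.mem_coe, Multiset.mem_toFinset, mem_aroots]
  refine ⟨minpoly.ne_zero hy, ?_⟩
  let τ' : F ≃ₐ[k⟮v⟯] F := AlgEquiv.ofRingEquiv (f := τ.toRingEquiv)
    fun z => forall_mem_adjoin_apply_eq hτ z z.2
  have : aeval (τ' y) (minpoly k⟮v⟯ y) = 0 := by
    rw [aeval_algHom_apply, minpoly.aeval, map_zero]
  exact this

theorem map_transcendental {x : F} (hx : Transcendental k x) (τ : F ≃ₐ[k] F) :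
    Transcendental k (τ x) :=
  fun h => hx ((isAlgebraic_algHom_iff (τ : F →ₐ[k] F) τ.injective).1 h)

theorem pow_expChar_pow_inj (p : ℕ) [ExpChar F p] (n : ℕ) {x y : F} (h : x ^ p ^ n = y ^ p ^ n) :
    x = y :=
  iterateFrobenius_inj F p n h

end Basic

section Luroth

variable {k F : Type*} [Field k] [Field F] [Algebra k F]

theorem exists_eq_adjoin_of_le [IsAlgClosed k] {x : F} (hx : Transcendental k x)
    (N : IntermediateField k F) (hN : N ≤ k⟮x⟯) : ∃ z, N = k⟮z⟯ := by
  let f : RatFunc k →ₐ[k] F :=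
    k⟮x⟯.val.comp (RatFunc.algEquivOfTranscendental x hx : RatFunc k →ₐ[k] k⟮x⟯)
  have hf : N ≤ f.fieldRange := fun z hz =>
    ⟨(RatFunc.algEquivOfTranscendental x hx).symm ⟨z, hN hz⟩, by simp [f]⟩
  have h1 : (N.comap f).map f = N := by
    ext z
    constructor
    · rintro ⟨w, hw, rfl⟩
      exact hw
    · intro hz
      obtain ⟨w, rfl⟩ := hf hz
      exact ⟨w, hz, rfl⟩
  refine ⟨f (RatFunc.Luroth.generator (N.comap f)), ?_⟩
  conv_lhs => rw [← h1, RatFunc.Luroth.eq_adjoin_generator (E := N.comap f), adjoin_map,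
    Set.image_singleton]

theorem transcendental_of_pow_mem_adjoin [IsAlgClosed k] {z w : F} {n : ℕ}
    (hw : Transcendental k w) (hn : 0 < n) (h : w ^ n ∈ k⟮z⟯) : Transcendental k z := by
  by_contra hz
  obtain ⟨a, rfl⟩ := not_transcendental_iff.1 hz
  rw [adjoin_simple_eq_bot_iff.2 (IntermediateField.algebraMap_mem _ a), mem_bot] at h
  obtain ⟨b, hb⟩ := h
  exact hw (IsAlgebraic.of_pow hn (hb ▸ isAlgebraic_algebraMap b))

theorem exists_polynomial_of_finite_orbit [IsAlgClosed k] {x : F} (hx : Transcendental k x)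
    (V : Subgroup (F ≃ₐ[k] F)) (hfin : {y | ∃ τ ∈ V, τ x = y}.Finite) :
    ∃ P : F[X], (∀ τ ∈ V, ∀ i, τ (P.coeff i) = P.coeff i) ∧
      (∀ τ : F ≃ₐ[k] F, (∀ i, τ (P.coeff i) = P.coeff i) → ∃ σ ∈ V, τ x = σ x) ∧
      ∃ i, Transcendental k (P.coeff i) := by
  classical
  let S := hfin.toFinset
  have hS : ∀ y, y ∈ S ↔ ∃ τ ∈ V, τ x = y := fun y => by simp [S]
  let P : F[X] := ∏ y ∈ S, (X - C y)
  have hroot : ∀ y, eval y P = 0 ↔ y ∈ S := fun y => by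
    simp [P, eval_prod, Finset.prod_eq_zero_iff, sub_eq_zero]
  have hxS : x ∈ S := (hS x).2 ⟨1, V.one_mem, rfl⟩
  have hev : ∀ (τ : F ≃ₐ[k] F), (∀ i, τ (P.coeff i) = P.coeff i) → eval (τ x) P = 0 := by
    intro τ hτ
    have h1 : P.map (τ : F →+* F) = P := by
      ext i
      rw [coeff_map]
      exact hτ i
    have h2 := eval_map_apply (f := (τ : F →+* F)) (p := P) x
    rw [h1, (hroot x).2 hxS, map_zero] at h2
    exact h2
  refine ⟨P, fun τ hτ i => ?_, fun τ hτ => ?_, ?_⟩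
  · have h1 : P.map (τ : F →+* F) = P := by
      simp only [P, Polynomial.map_prod, Polynomial.map_sub, map_X, map_C]
      refine Finset.prod_bij (fun y _ => τ y) ?_ ?_ ?_ ?_
      · intro y hy
        obtain ⟨σ, hσ, rfl⟩ := (hS y).1 hy
        exact (hS _).2 ⟨τ * σ, V.mul_mem hτ hσ, rfl⟩
      · intro a _ b _ h
        exact τ.injective h
      · intro y hy
        obtain ⟨σ, hσ, rfl⟩ := (hS y).1 hy
        exact ⟨τ⁻¹ (σ x), (hS _).2 ⟨τ⁻¹ * σ, V.mul_mem (V.inv_mem hτ) hσ, rfl⟩,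
          τ.apply_symm_apply _⟩
      · intro y _
        rfl
    have h2 := congrArg (fun Q => coeff Q i) h1
    rwa [coeff_map] at h2
  · obtain ⟨σ, hσ, h⟩ := (hS _).1 ((hroot _).1 (hev τ hτ))
    exact ⟨σ, hσ, h.symm⟩
  · by_contra! hcon
    have h1 : P ∈ Polynomial.lifts (algebraMap k F) := by
      rw [lifts_iff_coeff_lifts]
      exact fun i => not_transcendental_iff.1 (hcon i)
    obtain ⟨Q, hQ⟩ := (mem_lifts _).1 h1
    apply hx
    refine ⟨Q, ?_, ?_⟩
    · rintro rfl
      have hm : P.Monic := monic_prod_of_monic _ _ fun y _ => monic_X_sub_C y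
      rw [Polynomial.map_zero] at hQ
      exact hm.ne_zero hQ.symm
    · rw [← eval_map_algebraMap, hQ]
      exact (hroot x).2 hxS

theorem exists_stabilizer_eq [IsAlgClosed k] [IsAlgClosed F] [TrdegOne k F] {x : F}
    (hx : Transcendental k x)
    (V : Subgroup (F ≃ₐ[k] F)) (hV : ∀ τ : F ≃ₐ[k] F, τ x = x → τ ∈ V)
    (hfin : {y | ∃ τ ∈ V, τ x = y}.Finite) :
    ∃ z, Transcendental k z ∧ ∀ τ, τ ∈ V ↔ τ z = z := by
  obtain ⟨P, hPV, hP, i, hi⟩ := exists_polynomial_of_finite_orbit hx V hfin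
  obtain ⟨p, hp⟩ := ExpChar.exists F
  obtain ⟨z, hz⟩ := exists_eq_adjoin_of_le hx (fixedField V ⊓ k⟮x⟯) inf_le_right
  have hpow : ∀ i, ∃ n : ℕ, P.coeff i ^ p ^ n ∈ k⟮z⟯ := by
    intro i
    have hm : P.coeff i ∈ fixedField V := fun τ => hPV τ τ.2 i
    obtain ⟨n, hn⟩ := exists_pow_mem_adjoin_of_fixed p hx
      (y := P.coeff i) fun τ hτ => hPV τ (hV τ hτ) i
    exact ⟨n, hz ▸ ⟨pow_mem hm _, hn⟩⟩
  have hzV : z ∈ fixedField V := (hz ▸ mem_adjoin_simple_self k z : z ∈ fixedField V ⊓ k⟮x⟯).1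
  refine ⟨z, ?_, fun τ => ⟨fun hτ => hzV ⟨τ, hτ⟩, fun hτ => ?_⟩⟩
  · obtain ⟨n, hn⟩ := hpow i
    exact transcendental_of_pow_mem_adjoin hi (pow_pos (expChar_pos F p) n) hn
  · obtain ⟨σ, hσ, h⟩ := hP τ fun i => by
      obtain ⟨n, hn⟩ := hpow i
      refine pow_expChar_pow_inj p n ?_
      rw [← map_pow]
      exact forall_mem_adjoin_apply_eq hτ _ hn
    have h2 : σ⁻¹ * τ ∈ V := hV _ (by
      rw [AlgEquiv.mul_apply, h]
      exact σ.symm_apply_apply x)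
    simpa using V.mul_mem hσ h2

end Luroth

section Continuity

variable {k F k' F' : Type*} [Field k] [Field F] [Algebra k F] [Field k'] [Field F']
  [Algebra k' F']

/-- The image under `e` of the stabilizer of any transcendental element has finite orbits. -/
def HasFiniteOrbits (e : (F ≃ₐ[k] F) ≃* (F' ≃ₐ[k'] F')) : Prop :=
  ∀ x : F, Transcendental k x → ∀ y : F', {z | ∃ τ : F ≃ₐ[k] F, τ x = x ∧ e τ y = z}.Finite

theorem exists_finset_of_continuous {e : (F ≃ₐ[k] F) ≃* (F' ≃ₐ[k'] F')}
    (he : @Continuous _ _ (autTop k F) (autTop k' F') e) (y : F') :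
    ∃ S : Finset F, ∀ τ : F ≃ₐ[k] F, (∀ s ∈ S, τ s = s) → e τ y = y := by
  let _ : TopologicalSpace F := ⊥
  let _ : TopologicalSpace F' := ⊥
  have : DiscreteTopology F' := ⟨rfl⟩
  have h1 : IsOpen ((fun g : F' → F' => g y) ⁻¹' {y}) :=
    (isOpen_discrete _).preimage (continuous_apply y)
  have h2 := @IsOpen.preimage _ _ (autTop k F) (autTop k' F') _ he
    {σ : F' ≃ₐ[k'] F' | σ y = y} (isOpen_induced_iff.2 ⟨_, h1, rfl⟩)
  obtain ⟨U, hU, hUe⟩ := isOpen_induced_iff.1 h2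
  have h3 : ((1 : F ≃ₐ[k] F) : F → F) ∈ U := by
    have : (1 : F ≃ₐ[k] F) ∈ (fun σ : F ≃ₐ[k] F => (σ : F → F)) ⁻¹' U := by
      rw [hUe]
      simp
    exact this
  obtain ⟨S, u, hu, hS⟩ := isOpen_pi_iff.1 hU _ h3
  refine ⟨S, fun τ hτ => ?_⟩
  have : τ ∈ (fun σ : F ≃ₐ[k] F => (σ : F → F)) ⁻¹' U := hS fun s hs => by
    change τ s ∈ u s
    rw [hτ s hs]
    exact (hu s hs).2
  rw [hUe] at this
  exact this

theorem hasFiniteOrbits_of_continuous [TrdegOne k F] {e : (F ≃ₐ[k] F) ≃* (F' ≃ₐ[k'] F')}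
    (he : @Continuous _ _ (autTop k F) (autTop k' F') e) : HasFiniteOrbits e := by
  intro x hx y
  obtain ⟨S, hS⟩ := exists_finset_of_continuous he y
  have hfin : {f : S → F | ∀ s : S, f s ∈ {z | ∃ τ : F ≃ₐ[k] F, τ x = x ∧ τ (s : F) = z}}.Finite :=
    Set.Finite.pi' fun s => finite_orbit hx (s : F)
  have hch : ∀ z : F', ∃ τ : F ≃ₐ[k] F, (∃ τ : F ≃ₐ[k] F, τ x = x ∧ e τ y = z) →
      τ x = x ∧ e τ y = z := fun z => by
    by_cases h : ∃ τ : F ≃ₐ[k] F, τ x = x ∧ e τ y = z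
    · exact ⟨h.choose, fun _ => h.choose_spec⟩
    · exact ⟨1, fun h' => absurd h' h⟩
  choose t ht using hch
  refine Set.Finite.of_injOn (f := fun z (s : S) => t z s) ?_ ?_ hfin
  · exact fun z hz s => ⟨t z, (ht z hz).1, rfl⟩
  · intro z hz w hw h
    have h1 := hS ((t z)⁻¹ * t w) fun s hs => by
      have h2 : t z s = t w s := congrFun h ⟨s, hs⟩
      rw [AlgEquiv.mul_apply, ← h2]
      exact (t z).symm_apply_apply s
    rw [map_mul, AlgEquiv.mul_apply, (ht w hw).2, map_inv] at h1
    rw [← (ht z hz).2]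
    conv_lhs => rw [← h1]
    exact ((e (t z)).apply_symm_apply w)

theorem exists_matching [IsAlgClosed k] [IsAlgClosed F] [TrdegOne k F]
    [IsAlgClosed k'] [TrdegOne k' F'] {e : (F ≃ₐ[k] F) ≃* (F' ≃ₐ[k'] F')}
    (he : HasFiniteOrbits e) (he' : HasFiniteOrbits e.symm) :
    ∃ x : F, ∃ y : F', Transcendental k x ∧ Transcendental k' y ∧
      ∀ τ : F ≃ₐ[k] F, τ x = x ↔ e τ y = y := by
  obtain ⟨x₀, hx₀⟩ := TrdegOne.exists_transcendental (k := k) (F := F)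
  obtain ⟨t, ht⟩ := TrdegOne.exists_transcendental (k := k') (F := F')
  let U : Subgroup (F' ≃ₐ[k'] F') :=
    (MulAction.stabilizer (F ≃ₐ[k] F) x₀).map e.toMonoidHom
  have hU : ∀ τ : F ≃ₐ[k] F, τ x₀ = x₀ → e τ ∈ U := fun τ hτ => ⟨τ, hτ, rfl⟩
  obtain ⟨P, hPU, -, i, hi⟩ := exists_polynomial_of_finite_orbit ht U <|
    (he x₀ hx₀ t).subset (by
      rintro _ ⟨_, ⟨τ, hτ, rfl⟩, rfl⟩
      exact ⟨τ, hτ, rfl⟩)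
  let V : Subgroup (F ≃ₐ[k] F) :=
    (MulAction.stabilizer (F' ≃ₐ[k'] F') (P.coeff i)).comap e.toMonoidHom
  obtain ⟨z, hz, hV⟩ := exists_stabilizer_eq hx₀ V (fun τ hτ => hPU _ (hU τ hτ) i) <|
    (he' _ hi x₀).subset (by
      rintro _ ⟨τ, hτ, rfl⟩
      exact ⟨e τ, hτ, by simp⟩)
  exact ⟨z, P.coeff i, hz, hi, fun τ => (hV τ).symm⟩

end Continuity

section Separability

variable {k F : Type*} [Field k] [Field F] [Algebra k F]

/-- The preimage of an intermediate field under an iterate of the Frobenius. -/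
def IntermediateField.comapFrobenius (p : ℕ) [ExpChar F p] (n : ℕ) (L : IntermediateField k F) :
    IntermediateField k F :=
  (L.toSubfield.comap (iterateFrobenius F p n)).toIntermediateField fun a => by
    change (algebraMap k F a) ^ p ^ n ∈ L
    exact pow_mem (IntermediateField.algebraMap_mem _ a) _

theorem exists_pow_mem_of_fg (p : ℕ) [ExpChar F p] {K L : IntermediateField k F} (hK : K.FG)
    (h : ∀ z ∈ K, ∃ n : ℕ, z ^ p ^ n ∈ L) : ∃ n : ℕ, ∀ z ∈ K, z ^ p ^ n ∈ L := by
  obtain ⟨S, rfl⟩ := hK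
  have hS : ∀ s : S, ∃ n : ℕ, (s : F) ^ p ^ n ∈ L := fun s => h s (subset_adjoin k _ s.2)
  choose n hn using hS
  let N := Finset.univ.sup n
  have hle : adjoin k (S : Set F) ≤ L.comapFrobenius p N := by
    rw [adjoin_le_iff]
    intro s hs
    have h1 : n ⟨s, hs⟩ ≤ N := Finset.le_sup (f := n) (Finset.mem_univ _)
    obtain ⟨m, hm⟩ := Nat.exists_eq_add_of_le h1
    change s ^ p ^ N ∈ L
    rw [hm, pow_add, pow_mul]
    exact pow_mem (hn ⟨s, hs⟩) _
  exact ⟨N, fun z hz => hle hz⟩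

theorem exists_pow_isSeparable (p : ℕ) [ExpChar F p] (E : IntermediateField k F)
    [Algebra.IsAlgebraic E F] (z : F) : ∃ n : ℕ, IsSeparable E (z ^ p ^ n) := by
  have : ExpChar (separableClosure E F) p :=
    (algebraMap (separableClosure E F) F).expChar
      (algebraMap (separableClosure E F) F).injective p
  obtain ⟨n, w, hw⟩ := IsPurelyInseparable.pow_mem (separableClosure E F) p z
  exact ⟨n, mem_separableClosure_iff.1 (hw ▸ w.2)⟩

theorem mem_of_isSeparable_of_pow_mem (p : ℕ) [ExpChar F p] (E : IntermediateField k F) {z : F}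
    (hz : IsSeparable E z) {n : ℕ} (h : z ^ p ^ n ∈ E) : z ∈ E := by
  have : ExpChar E p := (algebraMap E F).expChar (algebraMap E F).injective p
  have h1 := adjoin_simple_eq_adjoin_pow_expChar_pow_of_isSeparable E F hz p n
  have h2 : E⟮z ^ p ^ n⟯ = ⊥ := adjoin_simple_eq_bot_iff.2 (mem_bot.2 ⟨⟨_, h⟩, rfl⟩)
  have h3 := mem_adjoin_simple_self E z
  rw [h1, h2, mem_bot] at h3
  obtain ⟨w, rfl⟩ := h3
  exact w.2

theorem mem_of_forall_fixed [IsAlgClosed F] (p : ℕ) [ExpChar F p] (E : IntermediateField k F)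
    [Algebra.IsAlgebraic E F] {z : F} (hz : IsSeparable E z)
    (h : ∀ τ : F ≃ₐ[k] F, (∀ w ∈ E, τ w = w) → τ z = z) : z ∈ E := by
  obtain ⟨n, hn⟩ := exists_pow_mem_of_fixed p E h
  exact mem_of_isSeparable_of_pow_mem p E hz hn

theorem exists_pow_eq_of_mem_adjoin_image [PerfectField k] (p : ℕ) [ExpChar F p] (S : Set F) {z : F}
    (hz : z ^ p ∈ adjoin k ((· ^ p) '' S)) : z ∈ adjoin k S := by
  have : ExpChar k p := (algebraMap k F).expChar (algebraMap k F).injective p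
  have key : ∀ w ∈ adjoin k ((· ^ p) '' S), ∃ v ∈ adjoin k S, v ^ p = w := by
    intro w hw
    induction hw using adjoin_induction with
    | mem w hw =>
      obtain ⟨s, hs, rfl⟩ := hw
      exact ⟨s, subset_adjoin k S hs, rfl⟩
    | algebraMap a =>
      obtain ⟨b, rfl⟩ := surjective_frobenius k p a
      exact ⟨algebraMap k F b, IntermediateField.algebraMap_mem _ b, by
        rw [frobenius_def, map_pow]⟩
    | add x y _ _ hx hy =>
      obtain ⟨v, hv, rfl⟩ := hx
      obtain ⟨w, hw, rfl⟩ := hy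
      exact ⟨v + w, add_mem hv hw, add_pow_expChar ..⟩
    | inv x _ hx =>
      obtain ⟨v, hv, rfl⟩ := hx
      exact ⟨v⁻¹, inv_mem hv, inv_pow ..⟩
    | mul x y _ _ hx hy =>
      obtain ⟨v, hv, rfl⟩ := hx
      obtain ⟨w, hw, rfl⟩ := hy
      exact ⟨v * w, mul_mem hv hw, mul_pow ..⟩
  obtain ⟨v, hv, h⟩ := key _ hz
  exact frobenius_inj F p h ▸ hv

theorem mem_adjoin_of_pow_mem_of_mem_adjoin {p : ℕ} (hp : p.Prime) [ExpChar F p]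
    (E : IntermediateField k F)
    {s θ : F} (hθ : θ ^ p ∈ E) (hs : s ∈ E⟮θ⟯) (hsE : s ∉ E) : θ ∈ E⟮s⟯ := by
  by_cases hb : ∃ b : E, (b : F) ^ p = θ ^ p
  · obtain ⟨b, hb⟩ := hb
    have h : (b : F) = θ := frobenius_inj F p hb
    exact h ▸ IntermediateField.algebraMap_mem E⟮s⟯ b
  have hirr : Irreducible (X ^ p - C (⟨θ ^ p, hθ⟩ : E)) :=
    X_pow_sub_C_irreducible_of_prime hp fun b hb' => hb ⟨b, congrArg Subtype.val hb'⟩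
  have hev : aeval θ (X ^ p - C (⟨θ ^ p, hθ⟩ : E)) = 0 := by
    simp only [map_sub, map_pow, aeval_X, aeval_C]
    exact sub_self _
  have hmon : (X ^ p - C (⟨θ ^ p, hθ⟩ : E)).Monic := monic_X_pow_sub_C _ hp.ne_zero
  have hint : IsIntegral E θ := ⟨_, hmon, by rwa [← aeval_def]⟩
  have hfr : Module.finrank E E⟮θ⟯ = p := by
    rw [adjoin.finrank hint, ← minpoly.eq_of_irreducible_of_monic hirr hev hmon,
      natDegree_X_pow_sub_C]
  have : FiniteDimensional E E⟮θ⟯ := adjoin.finiteDimensional hint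
  have hle : E⟮s⟯ ≤ E⟮θ⟯ := adjoin_simple_le_iff.2 hs
  have hdvd := finrank_dvd_of_le_right hle
  rw [hfr] at hdvd
  rcases (Nat.dvd_prime hp).1 hdvd with h | h
  · rw [IntermediateField.finrank_eq_one_iff, adjoin_simple_eq_bot_iff, mem_bot] at h
    obtain ⟨w, rfl⟩ := h
    exact absurd w.2 hsE
  · rw [eq_of_le_of_finrank_eq hle (h.trans hfr.symm)]
    exact mem_adjoin_simple_self E θ

theorem mem_adjoin_pair_of_mem_adjoin_adjoin {t w z : F} (h : z ∈ (k⟮t⟯)⟮w⟯) :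
    z ∈ adjoin k {t, w} := by
  have h1 := adjoin_adjoin_left k {t} ({w} : Set F)
  rw [Set.singleton_union] at h1
  exact h1 ▸ (mem_restrictScalars k).2 h

theorem isSeparable_of_mem_adjoin_simple {a s : F} {E : Type*} [Field E] [Algebra E F]
    (ha : IsSeparable E a) (hs : s ∈ E⟮a⟯) : IsSeparable E s := by
  have h : E⟮a⟯ ≤ separableClosure E F :=
    adjoin_simple_le_iff.2 (mem_separableClosure_iff.2 ha)
  exact mem_separableClosure_iff.1 (h hs)

theorem adjoin_pair_le_restrictScalars (E : IntermediateField k F) {t w : F} (hw : w ∈ E) :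
    adjoin k {t, w} ≤ E⟮t⟯.restrictScalars k := by
  rw [adjoin_le_iff]
  rintro _ (rfl | rfl)
  · exact mem_adjoin_simple_self E _
  · exact IntermediateField.algebraMap_mem E⟮t⟯ (⟨_, hw⟩ : E)

theorem isSeparable_of_mem_adjoin_pair {t a w : F} (ha : IsSeparable k⟮t⟯ a)
    (hw : w ∈ adjoin k {t, a}) : IsSeparable k⟮t⟯ w := by
  refine isSeparable_of_mem_adjoin_simple ha ?_
  have := adjoin_pair_le_restrictScalars k⟮t⟯ (mem_adjoin_simple_self k t) (t := a)
  rw [Set.pair_comm] at this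
  exact this hw

theorem mem_adjoin_pair_of_isSeparable [PerfectField k] {p : ℕ} [ExpChar F p] {t s θ : F}
    (hθ : θ ^ p = t) (hsep : IsSeparable k⟮t⟯ (s ^ p)) : s ∈ adjoin k {θ, s ^ p} := by
  have : ExpChar k⟮t⟯ p := (algebraMap k⟮t⟯ F).expChar (algebraMap k⟮t⟯ F).injective p
  have h1 : s ^ p ∈ (k⟮t⟯)⟮(s ^ p) ^ p⟯ := by
    rw [← adjoin_simple_eq_adjoin_pow_expChar_of_isSeparable _ _ hsep]
    exact mem_adjoin_simple_self _ _
  apply exists_pow_eq_of_mem_adjoin_image p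
  rw [Set.image_pair, hθ]
  exact mem_adjoin_pair_of_mem_adjoin_adjoin h1

theorem exists_pow_eq_of_not_isSeparable [IsAlgClosed k] [IsAlgClosed F] {p : ℕ} (hp : p.Prime)
    [ExpChar F p] {K : IntermediateField k F} {t s : F} (htK : t ∈ K) (hsK : s ∈ K)
    (hs : ¬ IsSeparable k⟮t⟯ s) (hsep : IsSeparable k⟮t⟯ (s ^ p)) : ∃ w ∈ K, w ^ p = t := by
  obtain ⟨θ, hθ⟩ := IsAlgClosed.exists_pow_nat_eq t hp.pos
  have htE : t ∈ adjoin k {t, s ^ p} := subset_adjoin k _ (by simp)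
  have hsE : s ^ p ∈ adjoin k {t, s ^ p} := subset_adjoin k _ (by simp)
  have hθ' := mem_adjoin_of_pow_mem_of_mem_adjoin hp (adjoin k {t, s ^ p}) (hθ.symm ▸ htE)
    (adjoin_pair_le_restrictScalars _ hsE (mem_adjoin_pair_of_isSeparable hθ hsep))
    fun h => hs (isSeparable_of_mem_adjoin_pair hsep h)
  have hle : adjoin k {t, s ^ p} ≤ K := adjoin_le_iff.2 <| by
    rintro _ (rfl | rfl)
    · exact htK
    · exact pow_mem hsK p
  have hle' : (adjoin k {t, s ^ p})⟮s⟯ ≤ extendScalars hle := adjoin_simple_le_iff.2 hsK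
  exact ⟨θ, hle' hθ', hθ⟩

theorem isSeparable_of_not_pow [IsAlgClosed k] [IsAlgClosed F] [TrdegOne k F] (p : ℕ) [ExpChar F p]
    {K : IntermediateField k F} {t : F} (ht : Transcendental k t) (htK : t ∈ K)
    (hpow : ∀ w ∈ K, w ^ p ≠ t) {z : F} (hz : z ∈ K) : IsSeparable k⟮t⟯ z := by
  classical
  have := TrdegOne.isAlgebraic t ht
  have hp : p.Prime := (expChar_is_prime_or_one F p).resolve_right fun h =>
    hpow t htK (by rw [h, pow_one])
  obtain ⟨n, hn⟩ := exists_pow_isSeparable p k⟮t⟯ z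
  induction n with
  | zero => simpa using hn
  | succ n ih =>
    by_cases h : IsSeparable k⟮t⟯ (z ^ p ^ n)
    · exact ih h
    · rw [pow_succ, pow_mul] at hn
      obtain ⟨w, hw, hwt⟩ := exists_pow_eq_of_not_isSeparable hp htK (pow_mem hz _) h hn
      exact absurd hwt (hpow w hw)

end Separability

section Frobenius

/-- The integral powers of the Frobenius automorphism of an algebraically closed field. -/
noncomputable def frobZ (F : Type*) [Field F] [IsAlgClosed F] (p : ℕ) [ExpChar F p] (n : ℤ) :
    F ≃+* F :=
  (frobeniusEquiv F p : RingAut F) ^ n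

section

variable {F F' : Type*} [Field F] [IsAlgClosed F] [Field F'] [IsAlgClosed F'] {p : ℕ} [ExpChar F p]
  [ExpChar F' p]

theorem frobZ_zero (x : F) : frobZ F p 0 x = x := by
  simp [frobZ]

theorem frobZ_add (m n : ℤ) (x : F) : frobZ F p (m + n) x = frobZ F p m (frobZ F p n x) := by
  rw [frobZ, zpow_add]
  rfl

theorem frobZ_natCast (n : ℕ) (x : F) : frobZ F p n x = x ^ p ^ n := by
  induction n with
  | zero => simp [frobZ_zero]
  | succ n ih =>
    rw [Nat.cast_succ, add_comm, frobZ_add, ih]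
    have : frobZ F p 1 (x ^ p ^ n) = (x ^ p ^ n) ^ p := by
      simp [frobZ, frobenius_def]
    rw [this, pow_succ, pow_mul]

theorem frobZ_neg_frobZ (n : ℤ) (x : F) : frobZ F p (-n) (frobZ F p n x) = x := by
  rw [← frobZ_add, neg_add_cancel, frobZ_zero]

theorem frobZ_frobZ_neg (n : ℤ) (x : F) : frobZ F p n (frobZ F p (-n) x) = x := by
  rw [← frobZ_add, add_neg_cancel, frobZ_zero]

theorem map_frobZ (f : F →+* F') (n : ℤ) (x : F) : f (frobZ F p n x) = frobZ F' p n (f x) := by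
  obtain ⟨m, rfl | rfl⟩ := n.eq_nat_or_neg
  · rw [frobZ_natCast, frobZ_natCast, map_pow]
  · have h := congrArg f (frobZ_frobZ_neg (p := p) m x)
    rw [frobZ_natCast, map_pow, ← frobZ_natCast] at h
    rw [← h, frobZ_neg_frobZ]

theorem frobZ_one_left [ExpChar F 1] (n : ℤ) (x : F) : frobZ F 1 n x = x := by
  obtain ⟨m, rfl | rfl⟩ := n.eq_nat_or_neg
  · rw [frobZ_natCast, one_pow, pow_one]
  · have := frobZ_frobZ_neg (p := 1) (m : ℤ) x
    rwa [frobZ_natCast, one_pow, pow_one] at this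

end

variable {k F : Type*} [Field k] [Field F] [Algebra k F] [IsAlgClosed F] {p : ℕ} [ExpChar F p]

theorem frobZ_algEquiv (τ : F ≃ₐ[k] F) (n : ℤ) (x : F) : τ (frobZ F p n x) = frobZ F p n (τ x) :=
  map_frobZ (τ : F →+* F) n x

variable [IsAlgClosed k]

theorem exists_frobZ_algebraMap (n : ℤ) (a : k) :
    ∃ b : k, frobZ F p n (algebraMap k F a) = algebraMap k F b := by
  have : ExpChar k p := (algebraMap k F).expChar (algebraMap k F).injective p
  exact ⟨frobZ k p n a, (map_frobZ (algebraMap k F) n a).symm⟩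

theorem Transcendental.frobZ {x : F} (hx : Transcendental k x) (n : ℤ) :
    Transcendental k (frobZ F p n x) := by
  by_contra h
  obtain ⟨a, ha⟩ := not_transcendental_iff.1 h
  obtain ⟨b, hb⟩ := exists_frobZ_algebraMap (p := p) (F := F) (-n) a
  rw [ha, frobZ_neg_frobZ] at hb
  exact not_transcendental_iff.2 ⟨b, hb.symm⟩ hx

theorem exists_forall_mem_iff_frobZ_mem (p : ℕ) [ExpChar F p] (n : ℤ) (K : IntermediateField k F) :
    ∃ L : IntermediateField k F, ∀ z, z ∈ L ↔ frobZ F p n z ∈ K :=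
  exists_forall_mem_iff_apply_mem (frobZ F p n : F →+* F)
    (fun a => (exists_frobZ_algebraMap n a).imp fun _ hb => hb.symm) K

omit [IsAlgClosed F] [IsAlgClosed k] in
theorem notMem_adjoin_pow {y : F} (hy : Transcendental k y) {m : ℕ} (hm : 2 ≤ m) :
    y ∉ k⟮y ^ m⟯ := by
  intro h
  obtain ⟨r, s, hrs⟩ := (mem_adjoin_simple_iff k y).1 h
  have hy0 : y ≠ 0 := fun h0 => hy (h0 ▸ isAlgebraic_zero)
  have hs0 : aeval (y ^ m) s ≠ 0 := fun h0 => hy0 (by rw [hrs, h0, div_zero])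
  rw [eq_div_iff hs0] at hrs
  have h1 : aeval y (X * expand k m s) = aeval y (expand k m r) := by
    rw [map_mul, aeval_X, expand_aeval, expand_aeval, hrs]
  have h2 := transcendental_iff_injective.1 hy h1
  have hs : s ≠ 0 := fun h0 => hs0 (by rw [h0, map_zero])
  have h3 := congrArg natDegree h2
  rw [natDegree_X_mul ((expand_ne_zero (by omega)).2 hs), natDegree_expand, natDegree_expand] at h3
  have h4 : m ∣ 1 := (Nat.dvd_add_right (Dvd.intro_left s.natDegree rfl)).1
    (h3 ▸ Dvd.intro_left _ rfl)
  have := Nat.le_of_dvd one_pos h4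
  omega

omit [IsAlgClosed F] [IsAlgClosed k] in
theorem exists_forall_pow_ne [TrdegOne k F] (hp : p.Prime) {K : IntermediateField k F} (hK : K.FG)
    {x : F} (hx : Transcendental k x) : ∃ N : ℕ, ∀ w ∈ K, w ^ p ^ N ≠ x := by
  have := TrdegOne.isAlgebraic x hx
  obtain ⟨n, hn⟩ := exists_pow_mem_of_fg p (L := (separableClosure k⟮x⟯ F).restrictScalars k) hK
    fun z _ => (exists_pow_isSeparable p k⟮x⟯ z).imp fun n hn => mem_separableClosure_iff.2 hn
  refine ⟨n + 1, fun w hw h => ?_⟩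
  have h1 : IsSeparable k⟮x⟯ (w ^ p ^ n) := mem_separableClosure_iff.1 (hn w hw)
  rw [pow_succ, pow_mul] at h
  have h2 := mem_of_isSeparable_of_pow_mem p k⟮x⟯ h1 (n := 1)
    (by rw [pow_one, h]; exact mem_adjoin_simple_self k x)
  rw [← h] at h2 hx
  refine notMem_adjoin_pow (m := p) (fun h3 => hx (h3.pow p)) hp.two_le h2

theorem exists_frobZ_mem_iff [TrdegOne k F] (p : ℕ) [ExpChar F p] {K L : IntermediateField k F}
    (hK : K.FG) (hL : L.FG) (hKt : ∃ x ∈ K, Transcendental k x) (hLt : ∃ x ∈ L, Transcendental k x)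
    (h : ∀ τ : F ≃ₐ[k] F, (∀ z ∈ K, τ z = z) ↔ ∀ z ∈ L, τ z = z) :
    ∃ n : ℤ, ∀ z, z ∈ K ↔ frobZ F p n z ∈ L := by
  have halg : ∀ {M : IntermediateField k F}, (∃ x ∈ M, Transcendental k x) →
      Algebra.IsAlgebraic M F := fun {M} ⟨x, hx, hxt⟩ => by
    have := TrdegOne.isAlgebraic x hxt
    let _ : Algebra k⟮x⟯ M := (inclusion (adjoin_simple_le_iff.2 hx)).toAlgebra
    have : IsScalarTower k⟮x⟯ M F := IsScalarTower.of_algebraMap_eq' rfl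
    exact Algebra.IsAlgebraic.tower_top (K := k⟮x⟯) M
  have hLalg := halg hLt
  have hKalg := halg hKt
  rcases expChar_is_prime_or_one F p with hp | rfl
  swap
  · refine ⟨0, fun z => ⟨fun hz => ?_, fun hz => ?_⟩⟩
    · rw [frobZ_zero]
      obtain ⟨n, hn⟩ := exists_pow_mem_of_fixed 1 L fun τ hτ => (h τ).2 hτ z hz
      rwa [one_pow, pow_one] at hn
    · rw [frobZ_zero] at hz
      obtain ⟨n, hn⟩ := exists_pow_mem_of_fixed 1 K fun τ hτ => (h τ).1 hτ z hz
      rwa [one_pow, pow_one] at hn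
  obtain ⟨m, hm⟩ := exists_pow_mem_of_fg p hK
    fun z hz => exists_pow_mem_of_fixed p L fun τ hτ => (h τ).2 hτ z hz
  obtain ⟨x, hxK, hx⟩ := hKt
  obtain ⟨N, hN⟩ := exists_forall_pow_ne hp hL (hx.pow (pow_pos hp.pos m))
  obtain ⟨n, hn, hmin⟩ := Int.exists_least_of_bdd (P := fun n : ℤ => ∀ z ∈ K, frobZ F p n z ∈ L)
    ⟨m - N, fun n hn => by
      by_contra! hlt
      obtain ⟨d, hd⟩ := Int.eq_ofNat_of_zero_le (a := m - N - n) (by omega)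
      refine hN (frobZ F p d (frobZ F p n x)) ?_ ?_
      · rw [frobZ_natCast]
        exact pow_mem (hn x hxK) _
      · rw [← frobZ_natCast, ← frobZ_natCast, ← frobZ_add, ← frobZ_add]
        congr 2
        omega⟩
    ⟨m, fun z hz => frobZ_natCast (p := p) m z ▸ hm z hz⟩
  have hn' : ∃ z ∈ K, frobZ F p (n - 1) z ∉ L := by
    by_contra! hcon
    have := hmin _ hcon
    omega
  obtain ⟨w, hwK, hw⟩ := hn'
  have hpow : ∀ v ∈ L, v ^ p ≠ frobZ F p n w := fun v hv hvw => by
    apply hw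
    have h1 : frobZ F p 1 v = v ^ p := by
      have := frobZ_natCast (p := p) 1 v
      rwa [Nat.cast_one, pow_one] at this
    rw [← h1] at hvw
    have h2 : frobZ F p (n - 1) w = frobZ F p (-1) (frobZ F p n w) := by
      rw [← frobZ_add]
      congr 2
      omega
    rw [h2, ← hvw, frobZ_neg_frobZ]
    exact hv
  have hwt : Transcendental k (frobZ F p n w) := by
    by_contra hcon
    obtain ⟨a, ha⟩ := not_transcendental_iff.1 hcon
    have : ExpChar k p := (algebraMap k F).expChar (algebraMap k F).injective p
    obtain ⟨b, rfl⟩ := surjective_frobenius k p a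
    exact hpow (algebraMap k F b) (IntermediateField.algebraMap_mem _ b) (by
      rw [← ha, frobenius_def, map_pow])
  obtain ⟨J, hJ⟩ := exists_forall_mem_iff_frobZ_mem p (-n) K
  have hJK : ∀ z, z ∈ K ↔ frobZ F p n z ∈ J := fun z => by rw [hJ, frobZ_neg_frobZ]
  have hwJ := (hJK w).1 hwK
  have := halg ⟨_, hwJ, hwt⟩
  refine ⟨n, fun z => ⟨hn z, fun hz => (hJK z).2 ?_⟩⟩
  have hsep := isSeparable_of_not_pow p hwt (hn w hwK) hpow hz
  let _ : Algebra k⟮frobZ F p n w⟯ J := (inclusion (adjoin_simple_le_iff.2 hwJ)).toAlgebra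
  have : IsScalarTower k⟮frobZ F p n w⟯ J F := IsScalarTower.of_algebraMap_eq' rfl
  refine mem_of_forall_fixed p J (hsep.tower_top J) fun τ hτ => (h τ).1 (fun v hv => ?_) _ hz
  have h1 := hτ _ ((hJK v).1 hv)
  rw [frobZ_algEquiv] at h1
  exact (frobZ F p n).injective h1

end Frobenius

section Moebius

variable {k F : Type*} [Field k] [Field F] [Algebra k F]

theorem coeff_eq_zero_of_quadratic {x : F} (hx : Transcendental k x) {a b c : k}
    (h : algebraMap k F a * x ^ 2 + algebraMap k F b * x + algebraMap k F c = 0) :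
    a = 0 ∧ b = 0 ∧ c = 0 := by
  have h1 := (transcendental_iff.1 hx) (C a * X ^ 2 + C b * X + C c) (by simpa using h)
  have h2 : ∀ n, (C a * X ^ 2 + C b * X + C c : k[X]).coeff n = 0 := fun n => by simp [h1]
  refine ⟨?_, ?_, ?_⟩
  · simpa [coeff_X, coeff_C] using h2 2
  · simpa [coeff_X, coeff_C] using h2 1
  · simpa [coeff_X, coeff_C] using h2 0

theorem exists_moebius_of_adjoin_eq {x y : F} (hx : Transcendental k x) (h : k⟮y⟯ = k⟮x⟯) :
    ∃ a b c d : k, a * d - b * c ≠ 0 ∧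
      y * (algebraMap k F c * x + algebraMap k F d) = algebraMap k F a * x + algebraMap k F b := by
  let φ := RatFunc.algEquivOfTranscendental x hx
  let ψ : RatFunc k →ₐ[k] F := k⟮x⟯.val.comp (φ : RatFunc k →ₐ[k] k⟮x⟯)
  have hψX : ψ RatFunc.X = x := by simp [ψ, φ]
  have hy : y ∈ k⟮x⟯ := h ▸ mem_adjoin_simple_self k y
  set f := φ.symm ⟨y, hy⟩ with hf
  have hψf : ψ f = y := by simp [ψ, hf]
  have htop : k⟮f⟯ = ⊤ := by
    have h1 : (k⟮f⟯).map ψ = (k⟮(RatFunc.X : RatFunc k)⟯).map ψ := by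
      rw [adjoin_map, adjoin_map, Set.image_singleton, Set.image_singleton, hψf, hψX, h]
    rw [← RatFunc.adjoin_X]
    exact IntermediateField.map_injective ψ h1
  have hdeg : max f.num.natDegree f.denom.natDegree = 1 := by
    rw [← RatFunc.finrank_eq_max_natDegree, htop]
    exact IntermediateField.finrank_top
  obtain ⟨h1, h2⟩ := max_le_iff.1 hdeg.le
  have e1 := f.num.eq_X_add_C_of_natDegree_le_one h1
  have e2 := f.denom.eq_X_add_C_of_natDegree_le_one h2
  set a := f.num.coeff 1
  set b := f.num.coeff 0
  set c := f.denom.coeff 1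
  set d := f.denom.coeff 0
  refine ⟨a, b, c, d, fun h0 => ?_, ?_⟩
  · have key : C a * f.denom = C c * f.num := by
      rw [e1, e2]
      have : C (a * d) = (C (b * c) : k[X]) := by rw [sub_eq_zero.1 h0]
      simp only [C_mul] at this
      linear_combination this
    by_cases ha : a = 0
    · by_cases hc : c = 0
      · rw [ha, C_0, zero_mul, zero_add] at e1
        rw [hc, C_0, zero_mul, zero_add] at e2
        rw [e1, e2] at hdeg
        simp at hdeg
      · have hn : f.num = 0 := by
          rw [ha, C_0, zero_mul, eq_comm, mul_eq_zero, C_eq_zero] at key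
          exact key.resolve_left hc
        have hu := f.isCoprime_num_denom
        rw [hn, isCoprime_zero_left] at hu
        rw [hn, natDegree_eq_zero_of_isUnit hu] at hdeg
        simp at hdeg
    · have hu : IsUnit f.num := f.isCoprime_num_denom.isUnit_of_dvd' dvd_rfl
        ((IsUnit.dvd_mul_left (isUnit_C.2 (isUnit_iff_ne_zero.2 ha))).1 ⟨C c, by rw [key, mul_comm]⟩)
      have := coeff_eq_zero_of_natDegree_lt (p := f.num) (n := 1)
        (by rw [natDegree_eq_zero_of_isUnit hu]; exact one_pos)
      exact ha this
  · have hd : ψ (algebraMap k[X] (RatFunc k) f.denom) ≠ 0 :=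
      (map_ne_zero ψ).2 (RatFunc.algebraMap_ne_zero f.denom_ne_zero)
    have hev : ∀ P : k[X], ψ (algebraMap k[X] (RatFunc k) P) = aeval x P := by
      intro P
      have : (ψ.comp (Algebra.algHom k k[X] (RatFunc k))) = aeval x := by
        ext
        rw [aeval_X, ← hψX, ← RatFunc.algebraMap_X]
        rfl
      exact DFunLike.congr_fun this P
    have h3 : y * aeval x f.denom = aeval x f.num := by
      rw [← hψf, ← hev, ← hev, ← map_mul]
      congr 1
      nth_rewrite 1 [← f.num_div_denom]
      exact div_mul_cancel₀ _ (RatFunc.algebraMap_ne_zero f.denom_ne_zero)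
    rw [e1, e2] at h3
    simpa using h3

end Moebius

section Generators

variable {k F : Type*} [Field k] [Field F] [Algebra k F] [IsAlgClosed k]

/-- `y` is a transcendental generator of the field `L` over `k`. -/
def IsGen (L : IntermediateField k F) (y : F) : Prop :=
  Transcendental k y ∧ k⟮y⟯ = L

variable {L : IntermediateField k F} {x y : F} {σ : F ≃ₐ[k] F}

omit [IsAlgClosed k] in
theorem IsGen.ne_zero (hy : IsGen L y) : y ≠ 0 := by
  rintro rfl
  exact hy.1 isAlgebraic_zero

omit [IsAlgClosed k] in
theorem IsGen.mem (hy : IsGen L y) : y ∈ L :=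
  hy.2 ▸ mem_adjoin_simple_self k y

theorem IsGen.of_mem (hy : IsGen L y) (hx : x ∈ L) (h : y ∈ k⟮x⟯) : IsGen L x :=
  ⟨transcendental_of_pow_mem_adjoin hy.1 one_pos (by rwa [pow_one]),
    le_antisymm (adjoin_simple_le_iff.2 hx) (hy.2 ▸ adjoin_simple_le_iff.2 h)⟩

theorem IsGen.map (hy : IsGen L y) (hσ : ∀ z, σ z ∈ L ↔ z ∈ L) : IsGen L (σ y) := by
  refine hy.of_mem ((hσ y).2 hy.mem) ?_
  have h1 : σ.symm y ∈ k⟮y⟯ := by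
    rw [hy.2, ← hσ, AlgEquiv.apply_symm_apply]
    exact hy.mem
  have h2 : k⟮σ y⟯ = k⟮y⟯.map (σ : F →ₐ[k] F) := by
    rw [adjoin_map, Set.image_singleton]
    rfl
  rw [h2]
  exact ⟨_, h1, AlgEquiv.apply_symm_apply σ y⟩

theorem IsGen.inv (hy : IsGen L y) : IsGen L y⁻¹ :=
  hy.of_mem (inv_mem hy.mem) (by
    simpa using inv_mem (mem_adjoin_simple_self k y⁻¹))

theorem IsGen.affine (hy : IsGen L y) {a : k} (ha : a ≠ 0) (b : k) :
    IsGen L (algebraMap k F a * y + algebraMap k F b) := by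
  refine hy.of_mem (add_mem (mul_mem (IntermediateField.algebraMap_mem _ a) hy.mem)
    (IntermediateField.algebraMap_mem _ b)) ?_
  set z := algebraMap k F a * y + algebraMap k F b
  have ha' : algebraMap k F a ≠ 0 := (_root_.map_ne_zero _).2 ha
  have h : y = (algebraMap k F a)⁻¹ * (z - algebraMap k F b) := by
    simp only [z]
    field_simp
    ring
  rw [h]
  exact mul_mem (inv_mem (IntermediateField.algebraMap_mem _ a))
    (sub_mem (mem_adjoin_simple_self k z) (IntermediateField.algebraMap_mem _ b))

omit [IsAlgClosed k] in
theorem IsGen.exists_moebius (hx : IsGen L x) (hy : IsGen L y) :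
    ∃ a b c d : k, a * d - b * c ≠ 0 ∧
      y * (algebraMap k F c * x + algebraMap k F d) = algebraMap k F a * x + algebraMap k F b :=
  exists_moebius_of_adjoin_eq hx.1 (hy.2.trans hx.2.symm)

omit [IsAlgClosed k] in
theorem IsGen.eq_or_eq_inv_of_scaling (hx : IsGen L x) (hy : IsGen L y) {c c' : k} (hc' : c' ≠ 1)
    (hσx : σ x = algebraMap k F c * x) (hσy : σ y = algebraMap k F c' * y) :
    ∃ b : k, b ≠ 0 ∧ (y = algebraMap k F b * x ∨ y = algebraMap k F b * x⁻¹) := by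
  obtain ⟨p, q, r, s, hdet, h⟩ := hx.exists_moebius hy
  have hx0 : x ≠ 0 := hx.ne_zero
  have hc : c ≠ 0 := by
    rintro rfl
    rw [map_zero, zero_mul, map_eq_zero_iff _ σ.injective] at hσx
    exact hx0 hσx
  have h' := congrArg σ h
  simp only [map_mul, map_add, AlgEquiv.commutes, hσx, hσy] at h'
  obtain ⟨h1, -, h3⟩ := coeff_eq_zero_of_quadratic hx.1
    (a := c * (p * r) * (c' - 1)) (b := c' * p * s + c' * c * q * r - c * p * s - q * r)
    (c := q * s * (c' - 1)) (by
      simp only [map_mul, map_sub, map_add, map_one]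
      linear_combination (algebraMap k F r * x + algebraMap k F s) * h' -
        algebraMap k F c' * (algebraMap k F r * (algebraMap k F c * x) + algebraMap k F s) * h)
  have hpr : p * r = 0 := by simpa [hc, sub_ne_zero.2 hc'] using h1
  have hqs : q * s = 0 := by simpa [sub_ne_zero.2 hc'] using h3
  rcases mul_eq_zero.1 hpr with rfl | rfl
  · have hq : q ≠ 0 := by rintro rfl; simp at hdet
    have hr : r ≠ 0 := by rintro rfl; simp at hdet
    obtain rfl := (mul_eq_zero.1 hqs).resolve_left hq
    refine ⟨q / r, div_ne_zero hq hr, Or.inr ?_⟩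
    have hr' : algebraMap k F r ≠ 0 := (_root_.map_ne_zero _).2 hr
    rw [map_div₀]
    field_simp
    simpa [mul_comm, mul_left_comm] using h
  · have hp : p ≠ 0 := by rintro rfl; simp at hdet
    have hs : s ≠ 0 := by rintro rfl; simp at hdet
    obtain rfl := (mul_eq_zero.1 hqs).resolve_right hs
    refine ⟨p / s, div_ne_zero hp hs, Or.inl ?_⟩
    have hs' : algebraMap k F s ≠ 0 := (_root_.map_ne_zero _).2 hs
    rw [map_div₀]
    field_simp
    simpa [mul_comm, mul_left_comm] using h

theorem IsGen.exists_affine (hy : IsGen L y) (hσ : ∀ z, σ z ∈ L ↔ z ∈ L) :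
    ∃ z, IsGen L z ∧ ∃ c d : k, σ z = algebraMap k F c * z + algebraMap k F d := by
  obtain ⟨p, q, s, v, hdet, h⟩ := hy.exists_moebius (hy.map hσ)
  by_cases hs : s = 0
  · subst hs
    have hv : v ≠ 0 := by rintro rfl; simp at hdet
    have hv' : algebraMap k F v ≠ 0 := (_root_.map_ne_zero _).2 hv
    refine ⟨y, hy, p / v, q / v, ?_⟩
    rw [map_div₀, map_div₀]
    field_simp
    simpa [mul_comm, mul_left_comm] using h
  · obtain ⟨t, ht⟩ := IsAlgClosed.exists_root (C s * X ^ 2 + C (v - p) * X + C (-q))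
      (by rw [degree_quadratic hs]; simp)
    have ht' : s * t ^ 2 + (v - p) * t - q = 0 := by simpa [IsRoot, sub_eq_add_neg] using ht
    have hps : p - t * s ≠ 0 := by
      intro h0
      apply hdet
      obtain rfl : p = t * s := sub_eq_zero.1 h0
      linear_combination s * ht'
    have hg : IsGen L (y - algebraMap k F t)⁻¹ := by
      have := (hy.affine one_ne_zero (-t)).inv
      simpa [sub_eq_add_neg] using this
    refine ⟨_, hg, (v + s * t) / (p - t * s), s / (p - t * s), ?_⟩
    have hps' : algebraMap k F (p - t * s) ≠ 0 := (_root_.map_ne_zero _).2 hps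
    have hy0 : y - algebraMap k F t ≠ 0 := by
      simpa using inv_ne_zero hg.ne_zero
    have hσ0 : σ y - algebraMap k F t ≠ 0 := by
      have := σ.injective.ne hy0
      simpa using this
    have ht2 := congrArg (algebraMap k F) ht'
    rw [map_inv₀, map_sub, AlgEquiv.commutes, map_div₀, map_div₀]
    refine inv_eq_of_mul_eq_one_right ?_
    simp only [map_sub, map_mul, map_add, map_pow, map_zero] at ht2 hps' ⊢
    field_simp
    linear_combination h - ht2

end Generators

theorem natCast_ne_zero_of_ringChar_lt {K : Type*} [Field K] {r : ℕ} (hr : r.Prime)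
    (h : ringChar K < r) : (r : K) ≠ 0 := fun h0 => by
  rcases (Nat.dvd_prime hr).1 ((ringChar.spec K r).1 h0) with h2 | h2
  · exact CharP.ringChar_ne_one h2
  · exact h.ne h2

section AffineAction

variable {k₀ k F : Type*} [Field k₀] [Field k] [Field F] [Algebra k F]

/-- Automorphisms `T a` and `V b` of `F` preserving `L` and behaving on `L` like the
transformations `x ↦ a x` and `x ↦ x + b` of the affine line over `k₀`. -/
structure IsAffineAction (L : IntermediateField k F) (T V : k₀ → F ≃ₐ[k] F) : Prop where
  T_mem : ∀ a ≠ 0, ∀ z, T a z ∈ L ↔ z ∈ L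
  V_mem : ∀ b, ∀ z, V b z ∈ L ↔ z ∈ L
  T_mul : ∀ a ≠ 0, ∀ b ≠ 0, ∀ z ∈ L, T (a * b) z = T a (T b z)
  V_add : ∀ b c, ∀ z ∈ L, V (b + c) z = V b (V c z)
  T_V : ∀ a ≠ 0, ∀ b, ∀ z ∈ L, T a (V b z) = V (b / a) (T a z)
  T_faithful : ∀ a ≠ 0, (∀ z ∈ L, T a z = z) → a = 1
  V_faithful : ∀ b, (∀ z ∈ L, V b z = z) → b = 0

variable {L : IntermediateField k F} {T V : k₀ → F ≃ₐ[k] F} (h : IsAffineAction L T V)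
include h

namespace IsAffineAction

theorem T_one {z : F} (hz : z ∈ L) : T 1 z = z := by
  have := h.T_mul 1 one_ne_zero 1 one_ne_zero z hz
  rw [mul_one] at this
  exact ((T 1).injective this).symm

theorem T_faithful' {y : F} (hy : IsGen L y) {a : k₀} (ha : a ≠ 0) (h1 : T a y = y) : a = 1 :=
  h.T_faithful a ha fun z hz => forall_mem_adjoin_apply_eq h1 z (hy.2.symm ▸ hz)

theorem V_faithful' {y : F} (hy : IsGen L y) {b : k₀} (h1 : V b y = y) : b = 0 :=
  h.V_faithful b fun z hz => forall_mem_adjoin_apply_eq h1 z (hy.2.symm ▸ hz)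

theorem T_pow_scaling {y : F} (hy : y ∈ L) {a : k₀} (ha : a ≠ 0) {c : k}
    (hc : T a y = algebraMap k F c * y) (n : ℕ) :
    T (a ^ n) y = algebraMap k F (c ^ n) * y := by
  induction n with
  | zero => simpa using h.T_one hy
  | succ n ih =>
    rw [pow_succ', h.T_mul a ha _ (pow_ne_zero n ha) y hy, ih, map_mul, AlgEquiv.commutes, hc,
      pow_succ, map_mul, mul_assoc]

theorem T_pow_translation {y : F} (hy : y ∈ L) {a : k₀} (ha : a ≠ 0) {d : k}
    (hd : T a y = y + algebraMap k F d) (n : ℕ) :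
    T (a ^ n) y = y + algebraMap k F (n * d) := by
  induction n with
  | zero => simpa using h.T_one hy
  | succ n ih =>
    rw [pow_succ', h.T_mul a ha _ (pow_ne_zero n ha) y hy, ih, map_add, AlgEquiv.commutes, hd]
    rw [Nat.cast_succ, add_mul, one_mul, map_add]
    ring

theorem exists_scaling_of_pow_eq_one [IsAlgClosed k] {x : F} (hx : IsGen L x) {r : ℕ}
    (hr : (r : k) ≠ 0) {a : k₀} (ha : a ≠ 0) (ha1 : a ≠ 1) (har : a ^ r = 1) :
    ∃ y, IsGen L y ∧ ∃ c : k, T a y = algebraMap k F c * y := by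
  obtain ⟨y, hy, c, d, hcd⟩ := hx.exists_affine (h.T_mem a ha)
  by_cases hc : c = 1
  · subst hc
    rw [map_one, one_mul] at hcd
    have h1 := h.T_pow_translation hy.mem ha hcd r
    rw [har, h.T_one hy.mem, left_eq_add, map_eq_zero_iff _ (algebraMap k F).injective,
      mul_eq_zero, or_iff_right hr] at h1
    rw [h1, map_zero, add_zero] at hcd
    exact absurd (h.T_faithful' hy ha hcd) ha1
  · have hc' : c - 1 ≠ 0 := sub_ne_zero.2 hc
    refine ⟨_, hy.affine hc' d, c, ?_⟩
    rw [map_add, map_mul, AlgEquiv.commutes, AlgEquiv.commutes, hcd]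
    simp only [map_sub, map_one]
    ring

theorem exists_scaling [IsAlgClosed k₀] [IsAlgClosed k] {x : F} (hx : IsGen L x) :
    ∃ y, IsGen L y ∧ (∀ a ≠ 0, ∃ c : k, c ≠ 0 ∧ T a y = algebraMap k F c * y) ∧
      ∃ a c, a ≠ 0 ∧ T a y = algebraMap k F c * y ∧ ∀ n < 5, n ≠ 0 → c ^ n ≠ 1 := by
  obtain ⟨r, hr5, hr⟩ := Nat.exists_infinite_primes (5 + ringChar k₀ + ringChar k)
  have hr0 := natCast_ne_zero_of_ringChar_lt (K := k₀) hr (by omega)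
  have hr1 := natCast_ne_zero_of_ringChar_lt (K := k) hr (by omega)
  have : NeZero (r : k₀) := ⟨hr0⟩
  obtain ⟨a, har⟩ := HasEnoughRootsOfUnity.exists_primitiveRoot k₀ r
  have ha : a ≠ 0 := har.ne_zero hr.ne_zero
  have han : ∀ n < 5, n ≠ 0 → a ^ n ≠ 1 := fun n hn hn0 =>
    har.pow_ne_one_of_pos_of_lt hn0 (by omega)
  obtain ⟨y, hy, c, hc⟩ := h.exists_scaling_of_pow_eq_one hx hr1 ha
    (by simpa using han 1 (by omega) one_ne_zero) har.pow_eq_one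
  have hcn : ∀ n < 5, n ≠ 0 → c ^ n ≠ 1 := fun n hn hn0 hcn => by
    have := h.T_pow_scaling hy.mem ha hc n
    rw [hcn, map_one, one_mul] at this
    exact han n hn hn0 (h.T_faithful' hy (pow_ne_zero n ha) this)
  refine ⟨y, hy, fun b hb => ?_, a, c, ha, hc, hcn⟩
  have h1 : T a (T b y) = algebraMap k F c * T b y := by
    rw [← h.T_mul a ha b hb y hy.mem, mul_comm, h.T_mul b hb a ha y hy.mem, hc, map_mul,
      AlgEquiv.commutes]
  obtain ⟨l, hl, h2 | h2⟩ := hy.eq_or_eq_inv_of_scaling (hy.map (h.T_mem b hb))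
    (by simpa using hcn 1 (by omega) one_ne_zero) hc h1
  · exact ⟨l, hl, h2⟩
  · exfalso
    apply hcn 2 (by omega) two_ne_zero
    have hl' : algebraMap k F l ≠ 0 := (_root_.map_ne_zero _).2 hl
    have hy0 := hy.ne_zero
    have hc0 : algebraMap k F c ≠ 0 := by
      intro h0
      rw [h0, zero_mul, map_eq_zero_iff _ (T a).injective] at hc
      exact hy0 hc
    rw [h2, map_mul, AlgEquiv.commutes, map_inv₀, hc] at h1
    field_simp at h1
    apply (algebraMap k F).injective
    rw [map_pow, map_one, ← h1]

theorem V_injective [IsAlgClosed k] {y : F} (hy : IsGen L y) {b c : k₀} (hbc : V b y = V c y) : b = c := by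
  have h1 := h.V_add (b - c) c y hy.mem
  rw [sub_add_cancel, ← hbc] at h1
  exact sub_eq_zero.1 (h.V_faithful' (hy.map (h.V_mem b)) h1.symm)

theorem V_comm {z : F} (hz : z ∈ L) (b c : k₀) : V b (V c z) = V c (V b z) := by
  rw [← h.V_add b c z hz, add_comm, h.V_add c b z hz]

theorem scaling_V_inv {y : F} (hy : y ∈ L) {a : k₀} (ha : a ≠ 0) {c : k}
    (hc : T a y = algebraMap k F c * y) :
    T a (V 1 y) = algebraMap k F c * V (1 / a) y := by
  rw [h.T_V a ha 1 y hy, hc, map_mul, AlgEquiv.commutes]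

theorem exists_translation_of_affine [IsAlgClosed k] {y : F} (hy : IsGen L y) {a : k₀}
    (ha : a ≠ 0) {c : k} (hc : T a y = algebraMap k F c * y) (hc1 : c ≠ 1) {e d : k}
    (hV : V 1 y = algebraMap k F e * y + algebraMap k F d) :
    d ≠ 0 ∧ V 1 y = y + algebraMap k F d := by
  have hc0 : c ≠ 0 := by
    rintro rfl
    rw [map_zero, zero_mul, map_eq_zero_iff _ (T a).injective] at hc
    exact hy.ne_zero hc
  have hw := h.scaling_V_inv hy.mem ha hc
  have hd : d ≠ 0 := by
    rintro rfl
    rw [map_zero, add_zero] at hV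
    rw [hV, map_mul, AlgEquiv.commutes, hc, mul_left_comm, mul_right_inj'
      ((_root_.map_ne_zero _).2 hc0), ← hV] at hw
    have h1 := h.V_injective hy hw
    rw [eq_div_iff ha, one_mul] at h1
    rw [h1, h.T_one hy.mem] at hc
    apply hc1
    apply (algebraMap k F).injective
    rw [map_one]
    exact (mul_eq_right₀ hy.ne_zero).1 hc.symm
  refine ⟨hd, ?_⟩
  have h2 := h.V_comm hy.mem 1 (1 / a)
  have h3 := congrArg (V 1) hw
  rw [hV] at h2 h3
  simp only [map_mul, map_add, AlgEquiv.commutes, h2, hc, hV] at h3 hw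
  have h4 : algebraMap k F ((e - 1) * d * (c - 1)) = 0 := by
    simp only [map_mul, map_sub, map_one]
    linear_combination h3 - algebraMap k F e * hw
  rw [map_eq_zero_iff _ (algebraMap k F).injective] at h4
  simp only [mul_eq_zero, sub_eq_zero, hd, hc1, or_false] at h4
  rw [hV, h4, map_one, one_mul]

theorem moebius_comm {y : F} (hy : IsGen L y) {p q s v : k} (hdet : p * v - q * s ≠ 0)
    (hV : V 1 y * (algebraMap k F s * y + algebraMap k F v) =
      algebraMap k F p * y + algebraMap k F q)
    {a : k₀} (ha : a ≠ 0) {c : k} (hc : T a y = algebraMap k F c * y) (hc1 : c ≠ 1)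
    (hs : s ≠ 0) :
    q * s * p * (c ^ 2 + c + 1) + c * (p ^ 3 - p ^ 2 * v + q * s * v) = 0 ∧
      (p = 0 → v = 0 → c ^ 4 = 1) := by
  have hc0 : c ≠ 0 := by
    rintro rfl
    rw [map_zero, zero_mul, map_eq_zero_iff _ (T a).injective] at hc
    exact hy.ne_zero hc
  have hw := h.scaling_V_inv hy.mem ha hc
  have h1 := congrArg (T a) hV
  simp only [map_mul, map_add, AlgEquiv.commutes, hc, hw] at h1
  have h2 := congrArg (V (1 / a)) hV
  have h3 := congrArg (V 1) h1
  simp only [map_mul, map_add, AlgEquiv.commutes] at h2 h3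
  rw [h.V_comm hy.mem] at h3
  set m := V (1 / a) (V 1 y)
  set w := V (1 / a) y
  set z := V 1 y
  set β := algebraMap k F c with hβ
  set P := algebraMap k F p with hP
  set Q := algebraMap k F q with hQ
  set S := algebraMap k F s with hS
  set R := algebraMap k F v with hR
  have e1 : β * (P * w + Q) * (S * (β * z) + R) = (P * (β * z) + Q) * (S * w + R) := by
    linear_combination (S * w + R) * h3 - β * (S * (β * z) + R) * h2
  have e2 : β * (P * (P * (β * y) + Q) + Q * (β * (S * (β * y) + R))) *
      (S * β * (P * y + Q) + R * (S * y + R)) =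
      (P * β * (P * y + Q) + Q * (S * y + R)) *
        (S * (P * (β * y) + Q) + R * (β * (S * (β * y) + R))) := by
    rw [← hV, ← h1]
    linear_combination (β * (S * (β * y) + R)) * (S * y + R) * e1
  obtain ⟨e3, e4, -⟩ := coeff_eq_zero_of_quadratic hy.1
    (a := c * (p ^ 2 * c + q * s * c ^ 2) * (s * c * p + v * s) -
      (p ^ 2 * c + q * s) * (s * p * c + v * s * c ^ 2))
    (b := c * ((p ^ 2 * c + q * s * c ^ 2) * (s * c * q + v ^ 2) +
      (p * q + q * v * c) * (s * c * p + v * s)) -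
      ((p ^ 2 * c + q * s) * (s * q + v ^ 2 * c) + (p * q * c + q * v) * (s * p * c + v * s * c ^ 2)))
    (c := c * (p * q + q * v * c) * (s * c * q + v ^ 2) - (p * q * c + q * v) * (s * q + v ^ 2 * c))
    (by
      simp only [map_mul, map_sub, map_add, map_pow, ← hβ, ← hP, ← hQ, ← hS, ← hR]
      linear_combination e2)
  have hc1' : c - 1 ≠ 0 := sub_ne_zero.2 hc1
  constructor
  · refine mul_left_cancel₀ (mul_ne_zero (mul_ne_zero hs hc0) hc1') ?_
    linear_combination e3
  · rintro rfl rfl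
    have hq : q ≠ 0 := by rintro rfl; simp at hdet
    refine mul_left_cancel₀ (mul_ne_zero (pow_ne_zero 2 hq) (pow_ne_zero 2 hs)) ?_
    linear_combination e4

theorem exists_normalized [IsAlgClosed k₀] [IsAlgClosed k] {x : F} (hx : IsGen L x) :
    ∃ y, IsGen L y ∧ (∀ a ≠ 0, ∃ c : k, c ≠ 0 ∧ T a y = algebraMap k F c * y) ∧
      V 1 y = y + 1 := by
  have main : ∀ y, IsGen L y → (∀ a ≠ 0, ∃ c : k, c ≠ 0 ∧ T a y = algebraMap k F c * y) →
      ∀ a c, a ≠ 0 → T a y = algebraMap k F c * y → c ≠ 1 → ∀ e d : k,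
      V 1 y = algebraMap k F e * y + algebraMap k F d →
      ∃ y, IsGen L y ∧ (∀ a ≠ 0, ∃ c : k, c ≠ 0 ∧ T a y = algebraMap k F c * y) ∧
        V 1 y = y + 1 := by
    intro y hy hT a c ha hc hc1 e d hV
    obtain ⟨hd, hV'⟩ := h.exists_translation_of_affine hy ha hc hc1 hV
    have hd' : algebraMap k F d ≠ 0 := (_root_.map_ne_zero _).2 hd
    refine ⟨_, hy.affine (inv_ne_zero hd) 0, fun b hb => ?_, ?_⟩
    · obtain ⟨l, hl, hbl⟩ := hT b hb
      refine ⟨l, hl, ?_⟩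
      rw [map_zero, add_zero, map_mul, AlgEquiv.commutes, hbl, mul_left_comm]
    · rw [map_zero, add_zero, map_mul, AlgEquiv.commutes, hV', map_inv₀, mul_add,
        inv_mul_cancel₀ hd']
  obtain ⟨y, hy, hT, a, c, ha, hc, hcn⟩ := h.exists_scaling hx
  have hc1 : c ≠ 1 := by simpa using hcn 1 (by omega) one_ne_zero
  have hc3 : c ^ 3 ≠ 1 := hcn 3 (by omega) three_ne_zero
  have hc0 : c ≠ 0 := by
    rintro rfl
    rw [map_zero, zero_mul, map_eq_zero_iff _ (T a).injective] at hc
    exact hy.ne_zero hc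
  obtain ⟨p, q, s, v, hdet, hV⟩ := hy.exists_moebius (hy.map (h.V_mem 1))
  by_cases hs : s = 0
  · subst hs
    have hv : v ≠ 0 := by rintro rfl; simp at hdet
    have hv' : algebraMap k F v ≠ 0 := (_root_.map_ne_zero _).2 hv
    refine main y hy hT a c ha hc hc1 (p / v) (q / v) ?_
    rw [map_div₀, map_div₀]
    field_simp
    simpa [mul_comm, mul_left_comm] using hV
  by_cases hq : q = 0
  · subst hq
    have hp : p ≠ 0 := by rintro rfl; simp at hdet
    have hp' : algebraMap k F p ≠ 0 := (_root_.map_ne_zero _).2 hp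
    have hy0 := hy.ne_zero
    have hVy : V 1 y ≠ 0 := (map_ne_zero_iff _ (V 1).injective).2 hy0
    refine main y⁻¹ hy.inv (fun b hb => ?_) a c⁻¹ ha ?_ (by simpa using hc1) (v / p) (s / p) ?_
    · obtain ⟨l, hl, hbl⟩ := hT b hb
      exact ⟨l⁻¹, inv_ne_zero hl, by rw [map_inv₀, hbl, mul_inv, map_inv₀]⟩
    · rw [map_inv₀, hc, mul_inv, map_inv₀]
    · rw [map_inv₀, map_div₀, map_div₀]
      refine inv_eq_of_mul_eq_one_right ?_
      rw [map_zero, add_zero] at hV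
      field_simp
      linear_combination hV
  exfalso
  have key := fun n (hn : n < 5) (hn0 : n ≠ 0) => h.moebius_comm hy hdet hV (pow_ne_zero n ha)
    (h.T_pow_scaling hy.mem ha hc n) (hcn n hn hn0) hs
  have k1 := (key 1 (by omega) (by omega)).1
  have k2 := (key 2 (by omega) (by omega)).1
  obtain rfl : p = 0 := by
    have h1 : q * s * p * (c * (1 - c) * (c ^ 3 - 1)) = 0 := by
      linear_combination c ^ 2 * k1 - c * k2
    simpa [hq, hs, hc0, sub_eq_zero, hc1.symm, hc3] using h1
  have hv : v = 0 := by
    simpa [hq, hs, hc0] using k1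
  have h4 := (key 1 (by omega) (by omega)).2 rfl hv
  rw [pow_one] at h4
  exact hcn 4 (by omega) (by omega) h4

end IsAffineAction

end AffineAction

section Level

variable {k F : Type*} [Field k] [Field F] [Algebra k F] [IsAlgClosed F]

/-- `σ` maps `L` onto the image of `L` under the inverse of the `n`-th power of Frobenius. -/
def HasLevel (L : IntermediateField k F) (p : ℕ) [ExpChar F p] (σ : F ≃ₐ[k] F) (n : ℤ) : Prop :=
  ∀ z, z ∈ L ↔ frobZ F p n (σ z) ∈ L

variable {L : IntermediateField k F} {p : ℕ} [ExpChar F p] {σ τ : F ≃ₐ[k] F} {m n : ℤ}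

theorem HasLevel.mul (hσ : HasLevel L p σ m) (hτ : HasLevel L p τ n) :
    HasLevel L p (σ * τ) (m + n) := fun z => by
  rw [hτ z, hσ, frobZ_algEquiv, frobZ_add]
  rfl

theorem HasLevel.one : HasLevel L p 1 0 := fun z => by
  rw [frobZ_zero]
  rfl

theorem HasLevel.pow (hσ : HasLevel L p σ m) (N : ℕ) : HasLevel L p (σ ^ N) (N * m) := by
  induction N with
  | zero => simpa using HasLevel.one
  | succ N ih =>
    rw [pow_succ, Nat.cast_succ, add_mul, one_mul]
    exact ih.mul hσ

theorem HasLevel.inv (hσ : HasLevel L p σ m) : HasLevel L p σ⁻¹ (-m) := fun z => by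
  have h := hσ (frobZ F p (-m) (σ.symm z))
  rw [frobZ_algEquiv, frobZ_frobZ_neg, AlgEquiv.apply_symm_apply] at h
  exact h.symm

variable {y : F}

theorem HasLevel.eq_zero [IsAlgClosed k] (hp : p.Prime) (hy : IsGen L y) (hσ : HasLevel L p σ n)
    (h : σ y = y) : n = 0 := by
  have key : ∀ m : ℕ, 0 < m → ∀ z ∈ L, z ^ p ^ m ≠ y := by
    rintro m hm z hz rfl
    refine notMem_adjoin_pow (k := k) (m := p ^ m) (y := z) ?_ ?_ (hy.2.symm ▸ hz)
    · exact fun h => hy.1 (h.pow _)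
    · exact (Nat.one_lt_pow hm.ne' hp.one_lt)
  by_contra hn
  obtain ⟨m, rfl | rfl⟩ := n.eq_nat_or_neg
  · refine key m (by omega) (frobZ F p (-m) y) ?_ ?_
    · rw [hσ, frobZ_algEquiv, frobZ_frobZ_neg, h]
      exact hy.mem
    · rw [← frobZ_natCast, frobZ_frobZ_neg]
  · refine key m (by omega) (frobZ F p (-m) y) ?_ ?_
    · have := (hσ y).1 hy.mem
      rwa [h] at this
    · rw [← frobZ_natCast, frobZ_frobZ_neg]

theorem HasLevel.unique [IsAlgClosed k] (hp : p.Prime) (hy : IsGen L y) (hσ : HasLevel L p σ m)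
    (hτ : HasLevel L p τ n) (h : σ y = τ y) : m = n := by
  have h1 := (hσ.inv.mul hτ).eq_zero hp hy (by
    rw [AlgEquiv.mul_apply, ← h]
    exact AlgEquiv.symm_apply_apply σ y)
  omega

theorem exists_hasLevel [IsAlgClosed k] [TrdegOne k F] (p : ℕ) [ExpChar F p] (hy : IsGen L y)
    (h : ∀ τ : F ≃ₐ[k] F, τ (σ y) = σ y ↔ τ y = y) : ∃ n, HasLevel L p σ n := by
  have hfix : ∀ (w : F) (τ : F ≃ₐ[k] F), (∀ z ∈ k⟮w⟯, τ z = z) ↔ τ w = w := fun w τ =>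
    ⟨fun h => h w (mem_adjoin_simple_self k w), fun h => forall_mem_adjoin_apply_eq h⟩
  have h' : ∀ τ : F ≃ₐ[k] F, τ (σ.symm y) = σ.symm y ↔ τ y = y := fun τ => by
    have h1 : (σ * τ * σ⁻¹) (σ y) = σ (τ y) := congrArg (fun w => σ (τ w)) (σ.symm_apply_apply y)
    have h2 : (σ * τ * σ⁻¹) y = σ (τ (σ.symm y)) := rfl
    rw [← σ.injective.eq_iff (a := τ y), ← h1, h, h2, ← σ.eq_symm_apply]
  obtain ⟨n, hn⟩ := exists_frobZ_mem_iff p (K := k⟮y⟯) (L := k⟮σ.symm y⟯)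
    (IntermediateField.fg_adjoin_of_finite (Set.finite_singleton _))
    (IntermediateField.fg_adjoin_of_finite (Set.finite_singleton _))
    ⟨y, mem_adjoin_simple_self k y, hy.1⟩
    ⟨σ.symm y, mem_adjoin_simple_self k _, map_transcendental hy.1 σ.symm⟩
    (fun τ => by rw [hfix, hfix, h'])
  refine ⟨n, fun z => ?_⟩
  rw [← hy.2, hn z, ← frobZ_algEquiv]
  have h2 : k⟮y⟯ = k⟮σ.symm y⟯.map (σ : F →ₐ[k] F) := by
    rw [adjoin_map, Set.image_singleton]
    exact congrArg (fun w => k⟮w⟯) (AlgEquiv.apply_symm_apply σ y).symm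
  rw [h2]
  exact (Set.InjOn.mem_image_iff (σ.injective.injOn) (Set.subset_univ _) (Set.mem_univ _)).symm

end Level

section Normalize

variable {k F k' F' : Type*} [Field k] [Field F] [Field k'] [Field F'] [Algebra k F] [Algebra k' F']
  [IsAlgClosed k] [IsAlgClosed F] [IsAlgClosed k'] [IsAlgClosed F'] [TrdegOne k F] [TrdegOne k' F']
  {e : (F ≃ₐ[k] F) ≃* (F' ≃ₐ[k'] F')} {x : F} {y : F'}

omit [IsAlgClosed k] [IsAlgClosed F] [IsAlgClosed k'] [IsAlgClosed F'] [TrdegOne k F]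
  [TrdegOne k' F'] in
theorem apply_eq_apply_iff_of_matching (h : ∀ τ, τ x = x ↔ e τ y = y) (σ τ : F ≃ₐ[k] F) :
    σ x = τ x ↔ e σ y = e τ y := by
  have h1 := h (τ⁻¹ * σ)
  rw [map_mul, map_inv] at h1
  change τ.symm (σ x) = x ↔ (e τ).symm (e σ y) = y at h1
  rwa [AlgEquiv.symm_apply_eq, AlgEquiv.symm_apply_eq] at h1

omit [IsAlgClosed k] [IsAlgClosed F] [IsAlgClosed k'] [IsAlgClosed F'] [TrdegOne k F]
  [TrdegOne k' F'] in
theorem apply_fixed_iff_of_matching (h : ∀ τ, τ x = x ↔ e τ y = y) (σ τ : F ≃ₐ[k] F) :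
    τ (σ x) = σ x ↔ e τ (e σ y) = e σ y := by
  have := apply_eq_apply_iff_of_matching h (τ * σ) σ
  rwa [map_mul] at this

omit [IsAlgClosed k] [IsAlgClosed F] [TrdegOne k F] in
theorem exists_hasLevel_of_matching (hy : Transcendental k' y) (h : ∀ τ, τ x = x ↔ e τ y = y)
    (p : ℕ) [ExpChar F' p] {σ : F ≃ₐ[k] F} (hσ : ∀ τ : F ≃ₐ[k] F, τ (σ x) = σ x ↔ τ x = x) :
    ∃ n, HasLevel k'⟮y⟯ p (e σ) n := by
  refine exists_hasLevel p ⟨hy, rfl⟩ fun τ => ?_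
  obtain ⟨τ, rfl⟩ := e.surjective τ
  rw [← apply_fixed_iff_of_matching h, hσ, h]

theorem hasLevel_zero_of_scaling (hx : Transcendental k x) (hy : Transcendental k' y)
    (h : ∀ τ, τ x = x ↔ e τ y = y) (p : ℕ) [ExpChar F' p] {σ : F ≃ₐ[k] F} {a : k} (ha : a ≠ 0)
    (hσ : σ x = algebraMap k F a * x) : HasLevel k'⟮y⟯ p (e σ) 0 := by
  have hlev : ∀ (b : k) (_ : b ≠ 0) (τ : F ≃ₐ[k] F), τ x = algebraMap k F b * x →
      ∃ n, HasLevel k'⟮y⟯ p (e τ) n := fun b hb τ hτ => by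
    refine exists_hasLevel_of_matching hy h p fun ρ => ?_
    rw [hτ, map_mul, AlgEquiv.commutes, mul_right_inj' ((_root_.map_ne_zero _).2 hb)]
  obtain ⟨n, hn⟩ := hlev a ha σ hσ
  rcases expChar_is_prime_or_one F' p with hp | rfl
  · obtain ⟨b, hb⟩ := IsAlgClosed.exists_pow_nat_eq a (n := n.natAbs + 1) (Nat.succ_pos _)
    have hb0 : b ≠ 0 := by
      rintro rfl
      rw [zero_pow (Nat.succ_ne_zero _)] at hb
      exact ha hb.symm
    have hbx : Transcendental k (algebraMap k F b * x) := by
      have := IsGen.affine (L := k⟮x⟯) ⟨hx, rfl⟩ hb0 0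
      simpa using this.1
    obtain ⟨τ, hτ⟩ := exists_algEquiv_apply_eq hx hbx
    obtain ⟨m, hm⟩ := hlev b hb0 τ hτ
    have hτn : ∀ N : ℕ, (τ ^ N) x = algebraMap k F (b ^ N) * x := fun N => by
      induction N with
      | zero => simp
      | succ N ih =>
        rw [pow_succ, AlgEquiv.mul_apply, hτ, map_mul, AlgEquiv.commutes, ih, pow_succ, map_mul]
        ring
    have h1 := (apply_eq_apply_iff_of_matching h σ (τ ^ (n.natAbs + 1))).1 (by rw [hτn, hb, hσ])
    rw [map_pow] at h1
    have h2 := hn.unique hp ⟨hy, rfl⟩ (hm.pow _) h1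
    obtain rfl : n = 0 := by
      by_contra hn0
      have hm0 : m ≠ 0 := by rintro rfl; simp at h2; exact hn0 h2
      have h3 := congrArg Int.natAbs h2
      rw [Int.natAbs_mul, Int.natAbs_natCast] at h3
      have h4 := Nat.le_mul_of_pos_right (n.natAbs + 1) (Int.natAbs_pos.2 hm0)
      rw [← h3] at h4
      omega
    exact hn
  · intro z
    rw [hn z, frobZ_one_left, frobZ_one_left]

theorem hasLevel_zero_of_translation (hx : Transcendental k x) (hy : Transcendental k' y)
    (h : ∀ τ, τ x = x ↔ e τ y = y) (p : ℕ) [ExpChar F' p] {σ : F ≃ₐ[k] F} {b : k}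
    (hσ : σ x = x + algebraMap k F b) : HasLevel k'⟮y⟯ p (e σ) 0 := by
  have hlev : ∀ (b : k) (τ : F ≃ₐ[k] F), τ x = x + algebraMap k F b →
      ∃ n, HasLevel k'⟮y⟯ p (e τ) n := fun b τ hτ => by
    refine exists_hasLevel_of_matching hy h p fun ρ => ?_
    rw [hτ, map_add, AlgEquiv.commutes, add_left_inj]
  have hgen : ∀ {a : k} (_ : a ≠ 0) (b : k),
      ∃ τ : F ≃ₐ[k] F, τ x = algebraMap k F a * x + algebraMap k F b := fun ha b =>
    exists_algEquiv_apply_eq hx (IsGen.affine (L := k⟮x⟯) ⟨hx, rfl⟩ ha b).1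
  obtain ⟨n, hn⟩ := hlev b σ hσ
  classical
  rcases expChar_is_prime_or_one F' p with hp | rfl
  · have key : ∀ (a : k) (_ : a ≠ 0) (τ : F ≃ₐ[k] F) (m : ℤ), τ x = x + algebraMap k F (a * b) →
        HasLevel k'⟮y⟯ p (e τ) m → m = n := by
      intro a ha τ m hτ hm
      obtain ⟨ρ, hρ⟩ := hgen ha 0
      rw [map_zero, add_zero] at hρ
      have hρ0 := hasLevel_zero_of_scaling hx hy h p ha hρ
      have h1 := (apply_eq_apply_iff_of_matching h (ρ * τ) (σ * ρ)).1 (by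
        simp only [AlgEquiv.mul_apply, hσ, hρ, hτ, map_mul, map_add, AlgEquiv.commutes]
        ring)
      rw [map_mul, map_mul] at h1
      have := (hρ0.mul hm).unique hp ⟨hy, rfl⟩ (hn.mul hρ0) h1
      omega
    obtain ⟨a, ha⟩ := Infinite.exists_notMem_finset ({0, -1} : Finset k)
    obtain ⟨ha0, ha1⟩ : a ≠ 0 ∧ a ≠ -1 := by simpa using ha
    obtain ⟨τ, hτ⟩ := hgen one_ne_zero (a * b)
    obtain ⟨ρ, hρ⟩ := hgen one_ne_zero ((a + 1) * b)
    rw [map_one, one_mul] at hτ hρ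
    obtain ⟨m, hm⟩ := hlev _ τ hτ
    obtain ⟨l, hl⟩ := hlev _ ρ hρ
    have h1 := key a ha0 τ m hτ hm
    have h2 := key (a + 1) (fun h0 => ha1 (eq_neg_of_add_eq_zero_left h0)) ρ l hρ hl
    have h3 := (apply_eq_apply_iff_of_matching h ρ (τ * σ)).1 (by
      simp only [AlgEquiv.mul_apply, hσ, hρ, hτ, map_mul, map_add, map_one, AlgEquiv.commutes]
      ring)
    rw [map_mul] at h3
    have h4 := hl.unique hp ⟨hy, rfl⟩ (hm.mul hn) h3
    obtain rfl : n = 0 := by omega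
    exact hn
  · intro z
    rw [hn z, frobZ_one_left, frobZ_one_left]

theorem exists_isAffineAction (hx : Transcendental k x) (hy : Transcendental k' y)
    (h : ∀ τ, τ x = x ↔ e τ y = y) :
    ∃ t u : k → F ≃ₐ[k] F, (∀ a ≠ 0, t a x = algebraMap k F a * x) ∧
      (∀ b, u b x = x + algebraMap k F b) ∧
      IsAffineAction k'⟮y⟯ (fun a => e (t a)) (fun b => e (u b)) := by
  have hgen : ∀ {a : k} (_ : a ≠ 0) (b : k),
      ∃ τ : F ≃ₐ[k] F, τ x = algebraMap k F a * x + algebraMap k F b := fun ha b =>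
    exists_algEquiv_apply_eq hx (IsGen.affine (L := k⟮x⟯) ⟨hx, rfl⟩ ha b).1
  have ht : ∀ a : k, ∃ τ : F ≃ₐ[k] F, a ≠ 0 → τ x = algebraMap k F a * x := fun a => by
    by_cases ha : a = 0
    · exact ⟨1, fun h => absurd ha h⟩
    · obtain ⟨τ, hτ⟩ := hgen ha 0
      exact ⟨τ, fun _ => by simpa using hτ⟩
  have hu : ∀ b : k, ∃ τ : F ≃ₐ[k] F, τ x = x + algebraMap k F b := fun b => by
    obtain ⟨τ, hτ⟩ := hgen one_ne_zero b
    exact ⟨τ, by simpa using hτ⟩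
  choose t ht using ht
  choose u hu using hu
  obtain ⟨p, _⟩ := ExpChar.exists F'
  have hmem : ∀ σ : F ≃ₐ[k] F, HasLevel k'⟮y⟯ p (e σ) 0 →
      ∀ z, e σ z ∈ k'⟮y⟯ ↔ z ∈ k'⟮y⟯ := fun σ hσ z => by
    rw [hσ z, frobZ_zero]
  have hrel : ∀ σ τ : F ≃ₐ[k] F, σ x = τ x → ∀ z ∈ k'⟮y⟯, e σ z = e τ z := fun σ τ hστ z hz => by
    have h1 := (h (τ⁻¹ * σ)).1 (by
      rw [AlgEquiv.mul_apply, hστ]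
      exact AlgEquiv.symm_apply_apply τ x)
    have h2 := forall_mem_adjoin_apply_eq h1 z hz
    rw [map_mul, map_inv] at h2
    exact ((e τ).symm_apply_eq).1 h2
  refine ⟨t, u, ht, hu, ⟨fun a ha => ?_, fun b => ?_, fun a ha b hb z hz => ?_, fun b c z hz => ?_,
    fun a ha b z hz => ?_, fun a ha h1 => ?_, fun b h1 => ?_⟩⟩
  · exact hmem _ (hasLevel_zero_of_scaling hx hy h p ha (ht a ha))
  · exact hmem _ (hasLevel_zero_of_translation hx hy h p (hu b))
  · have := hrel (t (a * b)) (t a * t b) (by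
      rw [AlgEquiv.mul_apply, ht b hb, map_mul, ht a ha, AlgEquiv.commutes,
        ht _ (mul_ne_zero ha hb), map_mul]
      ring) z hz
    rwa [map_mul] at this
  · have := hrel (u (b + c)) (u b * u c) (by
      rw [AlgEquiv.mul_apply, hu, hu, map_add, map_add, hu, AlgEquiv.commutes]
      ring) z hz
    rwa [map_mul] at this
  · have ha' : algebraMap k F a ≠ 0 := (_root_.map_ne_zero _).2 ha
    have := hrel (t a * u b) (u (b / a) * t a) (by
      rw [AlgEquiv.mul_apply, AlgEquiv.mul_apply, hu, map_add, ht a ha, map_mul,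
        AlgEquiv.commutes, AlgEquiv.commutes, hu, map_div₀]
      field_simp) z hz
    rwa [map_mul, map_mul] at this
  · have h2 := (h _).2 (h1 y (mem_adjoin_simple_self k' y))
    rw [ht a ha, mul_eq_right₀ (IsGen.ne_zero ⟨hx, rfl⟩)] at h2
    exact (algebraMap k F).injective (h2.trans (map_one _).symm)
  · have h2 := (h _).2 (h1 y (mem_adjoin_simple_self k' y))
    rwa [hu, add_eq_left, map_eq_zero_iff _ (algebraMap k F).injective] at h2

/-- The normalized pairs of coordinates matched by `e`. -/
structure IsNormalizedPair (e : (F ≃ₐ[k] F) ≃* (F' ≃ₐ[k'] F')) (x : F) (y : F') : Prop where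
  left : Transcendental k x
  right : Transcendental k' y
  fixed_iff : ∀ τ, τ x = x ↔ e τ y = y
  scaling : ∀ a : k, a ≠ 0 → ∃ c : k', c ≠ 0 ∧
    ∀ τ, τ x = algebraMap k F a * x → e τ y = algebraMap k' F' c * y
  translation : ∀ τ, τ x = x + 1 → e τ y = y + 1

theorem exists_isNormalizedPair (he : HasFiniteOrbits e) (he' : HasFiniteOrbits e.symm) :
    ∃ x y, IsNormalizedPair e x y := by
  obtain ⟨x, y₀, hx, hy₀, h₀⟩ := exists_matching he he'
  obtain ⟨t, u, ht, hu, h⟩ := exists_isAffineAction hx hy₀ h₀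
  obtain ⟨y, hy, hT, hV⟩ := h.exists_normalized ⟨hy₀, rfl⟩
  have hfix : ∀ τ, τ x = x ↔ e τ y = y := fun τ => by
    rw [h₀]
    exact ⟨fun h1 => forall_mem_adjoin_apply_eq h1 y hy.mem, fun h1 =>
      forall_mem_adjoin_apply_eq h1 y₀ (hy.2.symm ▸ mem_adjoin_simple_self k' y₀)⟩
  refine ⟨x, y, hx, hy.1, hfix, fun a ha => ?_, fun τ hτ => ?_⟩
  · obtain ⟨c, hc, hac⟩ := hT a ha
    refine ⟨c, hc, fun τ hτ => ?_⟩
    rw [← hac]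
    exact (apply_eq_apply_iff_of_matching hfix _ _).1 (hτ.trans (ht a ha).symm)
  · rw [← hV]
    exact (apply_eq_apply_iff_of_matching hfix _ _).1 (by rw [hτ, hu, map_one])

end Normalize

section Homogeneous

variable {k F : Type*} [Field k] [Field F] [Algebra k F] [IsAlgClosed k] [TrdegOne k F]

theorem exists_eq_mul_pow_of_homogeneous {y w : F} (hy : Transcendental k y) (n : ℕ)
    (h : {a : k | ∃ τ : F ≃ₐ[k] F, τ y = algebraMap k F a * y ∧
      τ w = algebraMap k F (a ^ n) * w}.Infinite) :
    ∃ c : k, w = algebraMap k F c * y ^ n := by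
  have hy0 : y ≠ 0 := IsGen.ne_zero (L := k⟮y⟯) ⟨hy, rfl⟩
  by_cases hv : Transcendental k (w / y ^ n)
  · exfalso
    refine h (Set.Finite.of_finite_image (f := fun a => algebraMap k F a * y) ?_ ?_)
    · refine (finite_orbit hv y).subset ?_
      rintro _ ⟨a, ⟨τ, hτy, hτw⟩, rfl⟩
      refine ⟨τ, ?_, hτy⟩
      have ha : algebraMap k F a ≠ 0 := by
        intro h0
        rw [h0, zero_mul, map_eq_zero_iff _ τ.injective] at hτy
        exact hy0 hτy
      rw [map_div₀, map_pow, hτy, hτw, map_pow, mul_pow, mul_div_mul_left _ _ (pow_ne_zero n ha)]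
    · intro a _ b _ hab
      exact (algebraMap k F).injective (mul_right_cancel₀ hy0 hab)
  · obtain ⟨c, hc⟩ := not_transcendental_iff.1 hv
    exact ⟨c, by rw [hc, div_mul_cancel₀ _ (pow_ne_zero n hy0)]⟩

end Homogeneous

section CoordMap

variable {k F k' F' : Type*} [Field k] [Field F] [Field k'] [Field F'] [Algebra k F] [Algebra k' F']

/-- An `e`-equivariant bijection compatible with the affine structure of `F` over `k`. -/
structure IsCoordMap (e : (F ≃ₐ[k] F) ≃* (F' ≃ₐ[k'] F')) (α : k →+* k') (φ : F → F') : Prop where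
  equivariant : ∀ τ z, φ (τ z) = e τ (φ z)
  bijective : Function.Bijective φ
  bijective_left : Function.Bijective α
  map_algebraMap : ∀ a, φ (algebraMap k F a) = algebraMap k' F' (α a)
  scaling : ∀ a z, φ (algebraMap k F a * z) = algebraMap k' F' (α a) * φ z
  translation : ∀ a z, φ (z + algebraMap k F a) = φ z + algebraMap k' F' (α a)

variable [IsAlgClosed k] [IsAlgClosed F] [IsAlgClosed k'] [IsAlgClosed F'] [TrdegOne k F]
  [TrdegOne k' F'] {e : (F ≃ₐ[k] F) ≃* (F' ≃ₐ[k'] F')} {x : F} {y : F'}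

theorem IsNormalizedPair.exists_isCoordMap (h : IsNormalizedPair e x y) :
    ∃ α φ, IsCoordMap e α φ := by
  have hfix := apply_eq_apply_iff_of_matching h.fixed_iff
  have hx0 : x ≠ 0 := IsGen.ne_zero (L := k⟮x⟯) ⟨h.left, rfl⟩
  have hy0 : y ≠ 0 := IsGen.ne_zero (L := k'⟮y⟯) ⟨h.right, rfl⟩
  have hα : ∀ a : k, ∃ c : k', (a = 0 → c = 0) ∧
      ∀ τ, τ x = algebraMap k F a * x → e τ y = algebraMap k' F' c * y := fun a => by
    by_cases ha : a = 0
    · refine ⟨0, fun _ => rfl, fun τ hτ => ?_⟩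
      rw [ha, map_zero, zero_mul, map_eq_zero_iff _ τ.injective] at hτ
      exact absurd hτ hx0
    · obtain ⟨c, -, hac⟩ := h.scaling a ha
      exact ⟨c, fun h0 => absurd h0 ha, hac⟩
  choose α hα0 hα using hα
  have hφ : ∀ z : F, ∃ w : F', (∀ τ : F ≃ₐ[k] F, τ x = z → w = e τ y) ∧
      ∀ a, algebraMap k F a = z → w = algebraMap k' F' (α a) := fun z => by
    by_cases hz : Transcendental k z
    · obtain ⟨σ, rfl⟩ := exists_algEquiv_apply_eq h.left hz
      exact ⟨e σ y, fun τ hτ => (hfix σ τ).1 hτ.symm, fun a ha =>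
        absurd hz (not_transcendental_iff.2 ⟨a, ha⟩)⟩
    · obtain ⟨a, rfl⟩ := not_transcendental_iff.1 hz
      exact ⟨algebraMap k' F' (α a), fun τ hτ => absurd (hτ ▸ map_transcendental h.left τ) hz,
        fun b hb => by rw [(algebraMap k F).injective hb]⟩
  choose φ hφ hφ' using hφ
  replace hφ : ∀ τ : F ≃ₐ[k] F, φ (τ x) = e τ y := fun τ => hφ _ τ rfl
  replace hφ' : ∀ a, φ (algebraMap k F a) = algebraMap k' F' (α a) := fun a => hφ' _ a rfl
  have hcase : ∀ z : F, (∃ τ : F ≃ₐ[k] F, τ x = z) ∨ ∃ a, algebraMap k F a = z := fun z => by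
    by_cases hz : Transcendental k z
    · exact Or.inl (exists_algEquiv_apply_eq h.left hz)
    · exact Or.inr (not_transcendental_iff.1 hz)
  have hequiv : ∀ τ z, φ (τ z) = e τ (φ z) := fun τ z => by
    obtain ⟨σ, rfl⟩ | ⟨a, rfl⟩ := hcase z
    · rw [hφ, ← AlgEquiv.mul_apply, hφ, map_mul, AlgEquiv.mul_apply]
    · rw [AlgEquiv.commutes, hφ', AlgEquiv.commutes]
  have hscale' : ∀ a : k, a ≠ 0 → ∃ τ : F ≃ₐ[k] F, τ x = algebraMap k F a * x := fun a ha =>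
    exists_algEquiv_apply_eq h.left (by
      simpa using (IsGen.affine (L := k⟮x⟯) ⟨h.left, rfl⟩ ha 0).1)
  have hscale : ∀ a (σ : F ≃ₐ[k] F), a ≠ 0 →
      φ (algebraMap k F a * σ x) = algebraMap k' F' (α a) * φ (σ x) := fun a σ ha => by
    obtain ⟨τ, hτ⟩ := hscale' a ha
    have : algebraMap k F a * σ x = (σ * τ) x := by
      rw [AlgEquiv.mul_apply, hτ, map_mul, AlgEquiv.commutes]
    rw [this, hφ, hφ, map_mul, AlgEquiv.mul_apply, hα a τ hτ, map_mul, AlgEquiv.commutes]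
  have hαmul : ∀ a b, α (a * b) = α a * α b := fun a b => by
    by_cases ha : a = 0
    · rw [ha, zero_mul, hα0 0 rfl, zero_mul]
    by_cases hb : b = 0
    · rw [hb, mul_zero, hα0 0 rfl, mul_zero]
    obtain ⟨τ, hτ⟩ := hscale' b hb
    have h1 := hscale (a * b) 1 (mul_ne_zero ha hb)
    have h2 := hscale a τ ha
    have h3 := hscale b 1 hb
    rw [AlgEquiv.one_apply] at h1 h3
    rw [hτ, h3, ← mul_assoc, ← map_mul, h1, ← mul_assoc, ← map_mul] at h2
    have hφx : φ x = y := by simpa using hφ 1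
    rw [hφx] at h2
    exact (algebraMap k' F').injective (mul_right_cancel₀ hy0 h2)
  have hαone : α 1 = 1 := by
    have := hα 1 1 (by simp)
    rw [map_one, AlgEquiv.one_apply, eq_comm, mul_eq_right₀ hy0] at this
    exact (algebraMap k' F').injective (this.trans (map_one _).symm)
  have htrans1 : ∀ σ : F ≃ₐ[k] F, φ (σ x + 1) = φ (σ x) + 1 := fun σ => by
    obtain ⟨τ, hτ⟩ : ∃ τ : F ≃ₐ[k] F, τ x = x + 1 := exists_algEquiv_apply_eq h.left (by
      simpa using (IsGen.affine (L := k⟮x⟯) ⟨h.left, rfl⟩ one_ne_zero 1).1)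
    have : σ x + 1 = (σ * τ) x := by
      rw [AlgEquiv.mul_apply, hτ, map_add, map_one]
    rw [this, hφ, hφ, map_mul, AlgEquiv.mul_apply, h.translation τ hτ, map_add, map_one]
  have htrans : ∀ a (σ : F ≃ₐ[k] F), φ (σ x + algebraMap k F a) =
      φ (σ x) + algebraMap k' F' (α a) := fun a σ => by
    by_cases ha : a = 0
    · rw [ha, hα0 0 rfl, map_zero, map_zero, add_zero, add_zero]
    have ha' : algebraMap k F a ≠ 0 := (_root_.map_ne_zero _).2 ha
    obtain ⟨τ, hτ⟩ := hscale' a⁻¹ (inv_ne_zero ha)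
    obtain ⟨ρ, hρ⟩ : ∃ ρ : F ≃ₐ[k] F, ρ x = (σ * τ) x + 1 := exists_algEquiv_apply_eq h.left (by
      simpa using (IsGen.affine (L := k⟮(σ * τ) x⟯) ⟨map_transcendental h.left _, rfl⟩
        one_ne_zero 1).1)
    have h1 : σ x = algebraMap k F a * (σ * τ) x := by
      rw [AlgEquiv.mul_apply, hτ, map_mul, AlgEquiv.commutes, map_inv₀, mul_inv_cancel_left₀ ha']
    have h2 : σ x + algebraMap k F a = algebraMap k F a * ρ x := by
      rw [hρ, mul_add, ← h1, mul_one]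
    rw [h2, hscale a ρ ha, hρ, htrans1, mul_add, mul_one, h1, hscale _ _ ha]
  have hαadd : ∀ a b, α (a + b) = α a + α b := fun a b => by
    obtain ⟨τ, hτ⟩ : ∃ τ : F ≃ₐ[k] F, τ x = x + algebraMap k F a :=
      exists_algEquiv_apply_eq h.left (by
        simpa using (IsGen.affine (L := k⟮x⟯) ⟨h.left, rfl⟩ one_ne_zero a).1)
    have h1 := htrans b τ
    have h2 := htrans a 1
    have h3 := htrans (a + b) 1
    rw [AlgEquiv.one_apply] at h2 h3
    rw [hτ, h2, add_assoc, ← map_add, h3, add_assoc, ← map_add] at h1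
    exact (algebraMap k' F').injective (add_left_cancel h1)
  let α' : k →+* k' :=
    { toFun := α, map_one' := hαone, map_mul' := hαmul, map_zero' := hα0 0 rfl, map_add' := hαadd }
  have hinj : ∀ σ τ : F ≃ₐ[k] F, φ (σ x) = φ (τ x) → σ x = τ x := fun σ τ h1 => by
    rw [hφ, hφ] at h1
    exact (hfix σ τ).2 h1
  have hsurj : Function.Surjective α' := fun c => by
    by_cases hc : c = 0
    · exact ⟨0, by rw [hc, map_zero]⟩
    obtain ⟨τ', hτ'⟩ := exists_algEquiv_apply_eq h.right (y := algebraMap k' F' c * y) (by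
      simpa using (IsGen.affine (L := k'⟮y⟯) ⟨h.right, rfl⟩ hc 0).1)
    obtain ⟨τ, rfl⟩ := e.surjective τ'
    obtain ⟨l, hl⟩ := exists_eq_mul_pow_of_homogeneous (w := τ x) h.left 1 (by
      refine (Set.finite_singleton (0 : k)).infinite_compl.mono fun a ha => ?_
      obtain ⟨σ, hσ⟩ := hscale' a ha
      refine ⟨σ, hσ, ?_⟩
      obtain ⟨ρ, hρ⟩ := exists_algEquiv_apply_eq h.left (y := algebraMap k F a * τ x) (by
        simpa using (IsGen.affine (L := k⟮τ x⟯) ⟨map_transcendental h.left τ, rfl⟩ ha 0).1)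
      rw [pow_one, ← hρ, ← AlgEquiv.mul_apply]
      apply hinj
      rw [hρ, hscale a τ ha, hφ, hφ, map_mul, AlgEquiv.mul_apply, hτ', map_mul, AlgEquiv.commutes,
        hα a σ hσ]
      ring)
    rw [pow_one] at hl
    refine ⟨l, ?_⟩
    have h1 := hα l τ hl
    rw [hτ'] at h1
    exact ((algebraMap k' F').injective (mul_right_cancel₀ hy0 h1)).symm
  have hφt : ∀ σ : F ≃ₐ[k] F, Transcendental k' (φ (σ x)) := fun σ => by
    rw [hφ]
    exact map_transcendental h.right _
  refine ⟨α', φ, hequiv, ⟨fun z w hzw => ?_, fun w => ?_⟩, ⟨α'.injective, hsurj⟩, hφ',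
    fun a z => ?_, fun a z => ?_⟩
  · obtain ⟨σ, rfl⟩ | ⟨a, rfl⟩ := hcase z <;> obtain ⟨τ, rfl⟩ | ⟨b, rfl⟩ := hcase w
    · exact hinj _ _ hzw
    · exact absurd (hφt σ) (not_transcendental_iff.2 ⟨α b, by rw [hzw, hφ']⟩)
    · exact absurd (hφt τ) (not_transcendental_iff.2 ⟨α a, by rw [← hzw, hφ']⟩)
    · rw [hφ', hφ'] at hzw
      rw [α'.injective ((algebraMap k' F').injective hzw)]
  · by_cases hw : Transcendental k' w
    · obtain ⟨τ', rfl⟩ := exists_algEquiv_apply_eq h.right hw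
      exact ⟨e.symm τ' x, by rw [hφ, MulEquiv.apply_symm_apply]⟩
    · obtain ⟨c, rfl⟩ := not_transcendental_iff.1 hw
      obtain ⟨a, rfl⟩ := hsurj c
      exact ⟨algebraMap k F a, hφ' a⟩
  · by_cases ha : a = 0
    · rw [ha, map_zero, map_zero, map_zero, zero_mul, zero_mul]
      simpa [hα0] using hφ' 0
    obtain ⟨σ, rfl⟩ | ⟨b, rfl⟩ := hcase z
    · exact hscale a σ ha
    · rw [← map_mul, hφ', hφ', ← map_mul]
      exact congrArg _ (hαmul a b)
  · obtain ⟨σ, rfl⟩ | ⟨b, rfl⟩ := hcase z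
    · exact htrans a σ
    · rw [← map_add, hφ', hφ', ← map_add]
      exact congrArg _ (hαadd b a)

end CoordMap

section Transcendental

variable {k F : Type*} [Field k] [Field F] [Algebra k F]

theorem transcendental_of_pow {x : F} {n : ℕ} (h : Transcendental k (x ^ n)) :
    Transcendental k x :=
  fun hx => h (hx.pow n)

variable [IsAlgClosed k]

theorem transcendental_affine {x : F} (hx : Transcendental k x) {a : k} (ha : a ≠ 0) (b : k) :
    Transcendental k (algebraMap k F a * x + algebraMap k F b) :=
  (IsGen.affine (L := k⟮x⟯) ⟨hx, rfl⟩ ha b).1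

theorem transcendental_mul_left {x : F} (hx : Transcendental k x) {a : k} (ha : a ≠ 0) :
    Transcendental k (algebraMap k F a * x) := by
  simpa using transcendental_affine hx ha 0

theorem transcendental_add_right {x : F} (hx : Transcendental k x) (b : k) :
    Transcendental k (x + algebraMap k F b) := by
  simpa using transcendental_affine hx one_ne_zero b

theorem transcendental_iff_notMem_bot {x : F} :
    Transcendental k x ↔ x ∉ (⊥ : IntermediateField k F) := by
  rw [← not_iff_not, not_transcendental_iff, not_not, IntermediateField.mem_bot, Set.mem_range]

omit [IsAlgClosed k] in
theorem ne_zero_of_transcendental {x : F} (hx : Transcendental k x) : x ≠ 0 :=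
  IsGen.ne_zero (L := k⟮x⟯) ⟨hx, rfl⟩

end Transcendental

namespace IsCoordMap

variable {k F k' F' : Type*} [Field k] [Field F] [Field k'] [Field F'] [Algebra k F] [Algebra k' F']
  {e : (F ≃ₐ[k] F) ≃* (F' ≃ₐ[k'] F')} {α : k →+* k'} {φ : F → F'}

theorem apply_zero (h : IsCoordMap e α φ) : φ 0 = 0 := by
  simpa using h.map_algebraMap 0

theorem apply_ne_zero (h : IsCoordMap e α φ) {x : F} (hx : x ≠ 0) : φ x ≠ 0 := by
  rw [← h.apply_zero]
  exact h.bijective.1.ne hx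

theorem apply_eq_iff (h : IsCoordMap e α φ) {τ : F ≃ₐ[k] F} {x : F} {a : k} :
    e τ (φ x) = algebraMap k' F' (α a) * φ x ↔ τ x = algebraMap k F a * x := by
  rw [← h.equivariant, ← h.scaling, h.bijective.1.eq_iff]

theorem fixed_iff (h : IsCoordMap e α φ) {τ : F ≃ₐ[k] F} {x : F} :
    e τ (φ x) = φ x ↔ τ x = x := by
  rw [← h.equivariant, h.bijective.1.eq_iff]

variable [IsAlgClosed k] [IsAlgClosed k']

theorem transcendental_iff (h : IsCoordMap e α φ) {x : F} :
    Transcendental k' (φ x) ↔ Transcendental k x := by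
  rw [← not_iff_not, not_transcendental_iff, not_transcendental_iff]
  constructor
  · rintro ⟨a, ha⟩
    obtain ⟨b, rfl⟩ := h.bijective_left.2 a
    exact ⟨b, h.bijective.1 (by rw [h.map_algebraMap, ha])⟩
  · rintro ⟨a, rfl⟩
    exact ⟨α a, (h.map_algebraMap a).symm⟩

variable [IsAlgClosed F] [TrdegOne k F] [TrdegOne k' F']

theorem apply_pow (h : IsCoordMap e α φ) {w : F} (hw : Transcendental k w) (n : ℕ) :
    ∃ c : k', φ (w ^ n) = algebraMap k' F' c * φ w ^ n := by
  refine exists_eq_mul_pow_of_homogeneous (h.transcendental_iff.2 hw) n ?_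
  refine ((Set.finite_singleton (0 : k')).infinite_compl).mono fun b hb => ?_
  obtain ⟨a, rfl⟩ := h.bijective_left.2 b
  have ha : a ≠ 0 := by
    rintro rfl
    exact hb (map_zero α)
  obtain ⟨τ, hτ⟩ := exists_algEquiv_apply_eq hw (transcendental_mul_left hw ha)
  refine ⟨e τ, h.apply_eq_iff.2 hτ, ?_⟩
  rw [← map_pow α, h.apply_eq_iff, map_pow, hτ, mul_pow, map_pow]

variable [IsAlgClosed F']

theorem apply_mul_of_transcendental (h : IsCoordMap e α φ) {x y : F} (hx : Transcendental k x)
    (hy : Transcendental k y) (hxy : Transcendental k (x * y)) :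
    ∃ c : k', φ (x * y) = algebraMap k' F' c * (φ x * φ y) := by
  classical
  have hx0 := h.apply_ne_zero (ne_zero_of_transcendental hx)
  have hy0 := h.apply_ne_zero (ne_zero_of_transcendental hy)
  by_contra! hc
  set z := φ (x * y) / (φ x * φ y) with hz
  have hzt : Transcendental k' z := by
    by_contra hn
    obtain ⟨c, hc'⟩ := not_transcendental_iff.1 hn
    exact hc c (by rw [hc', hz, div_mul_cancel₀ _ (mul_ne_zero hx0 hy0)])
  have hS := (finite_orbit hzt (φ x)).prod (finite_orbit hzt (φ y))
  obtain ⟨n, hn, hnp⟩ := Nat.exists_infinite_primes (hS.toFinset.card + ringChar k' + 1)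
  have hnk := natCast_ne_zero_of_ringChar_lt hnp (K := k') (by omega)
  have : NeZero (n : k') := ⟨hnk⟩
  obtain ⟨ζ, hζ⟩ := HasEnoughRootsOfUnity.exists_primitiveRoot k' n
  obtain ⟨u, rfl⟩ := IsAlgClosed.exists_pow_nat_eq x hnp.pos
  obtain ⟨v, rfl⟩ := IsAlgClosed.exists_pow_nat_eq y hnp.pos
  have hu := transcendental_of_pow hx
  have hv := transcendental_of_pow hy
  rw [← mul_pow] at hxy
  have huv := transcendental_of_pow hxy
  have hu0 := h.apply_ne_zero (ne_zero_of_transcendental hu)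
  have hv0 := h.apply_ne_zero (ne_zero_of_transcendental hv)
  have huv0 := h.apply_ne_zero (ne_zero_of_transcendental huv)
  obtain ⟨a, ha⟩ := h.apply_pow hu n
  obtain ⟨b, hb⟩ := h.apply_pow hv n
  obtain ⟨c, hc⟩ := h.apply_pow huv n
  set g := φ (u * v) / (φ u * φ v) with hg
  have hzg : z = algebraMap k' F' (c / (a * b)) * g ^ n := by
    rw [hz, hg, ← mul_pow, ha, hb, hc, map_div₀, map_mul, div_pow, mul_pow,
      div_mul_div_comm]
    ring_nf
  have hgt : Transcendental k' g := by
    intro hgalg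
    exact hzt (hzg ▸ (isAlgebraic_algebraMap _).mul (hgalg.pow n))
  have hg0 := ne_zero_of_transcendental hgt
  have hζ0 : ζ ≠ 0 := hζ.ne_zero hnp.ne_zero
  have hτ : ∀ i : ℕ, ∃ τ : F' ≃ₐ[k'] F', τ g = algebraMap k' F' (ζ ^ i) * g := fun i =>
    exists_algEquiv_apply_eq hgt (transcendental_mul_left hgt (pow_ne_zero i hζ0))
  choose τ hτ using hτ
  have hle : (Finset.range n).card ≤ hS.toFinset.card := by
    refine Finset.card_le_card_of_injOn (fun i => (τ i (φ (u ^ n)), τ i (φ (v ^ n)))) ?_ ?_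
    · intro i _
      have hτz : τ i z = z := by
        rw [hzg, map_mul, AlgEquiv.commutes, map_pow, hτ, mul_pow, ← map_pow, ← pow_mul, mul_comm i,
          pow_mul, hζ.pow_eq_one, one_pow, map_one, one_mul]
      rw [Finset.mem_coe, Set.Finite.mem_toFinset]
      exact ⟨⟨τ i, hτz, rfl⟩, ⟨τ i, hτz, rfl⟩⟩
    · intro i hi j hj hij
      rw [Prod.mk.injEq] at hij
      obtain ⟨ρ, hρ⟩ := e.surjective ((τ i)⁻¹ * τ j)
      have hfix : ∀ w, e ρ w = w ↔ τ i w = τ j w := fun w => by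
        rw [hρ, AlgEquiv.mul_apply]
        exact (τ i).toEquiv.symm_apply_eq.trans eq_comm
      have hscal : ∀ {w : F}, Transcendental k w → ρ (w ^ n) = w ^ n →
          ∃ a : k, ρ w = algebraMap k F a * w := fun {w} hw hwn => by
        have hw0 := ne_zero_of_transcendental hw
        have h1 : (ρ w / w) ^ n = 1 := by
          rw [div_pow, ← map_pow, hwn, div_self (pow_ne_zero n hw0)]
        have h2 : ¬ Transcendental k (ρ w / w) := fun ht => by
          have := ht.pow hnp.pos
          rw [h1] at this
          exact this isAlgebraic_one
        obtain ⟨a, ha⟩ := not_transcendental_iff.1 h2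
        exact ⟨a, by rw [ha, div_mul_cancel₀ _ hw0]⟩
      obtain ⟨r, hr⟩ := hscal hu (h.fixed_iff.1 ((hfix _).2 hij.1))
      obtain ⟨s, hs⟩ := hscal hv (h.fixed_iff.1 ((hfix _).2 hij.2))
      have hrs : ρ (u * v) = algebraMap k F (r * s) * (u * v) := by
        rw [map_mul, hr, hs, map_mul]
        ring
      have hr0 : algebraMap k' F' (α r) ≠ 0 := fun h0 => by
        have h1 := h.apply_eq_iff.2 hr
        rw [h0, zero_mul, map_eq_zero_iff _ (e ρ).injective] at h1
        exact hu0 h1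
      have hs0 : algebraMap k' F' (α s) ≠ 0 := fun h0 => by
        have h1 := h.apply_eq_iff.2 hs
        rw [h0, zero_mul, map_eq_zero_iff _ (e ρ).injective] at h1
        exact hv0 h1
      have hρg : e ρ g = g := by
        rw [hg, map_div₀, map_mul, h.apply_eq_iff.2 hr, h.apply_eq_iff.2 hs, h.apply_eq_iff.2 hrs,
          map_mul, map_mul]
        field_simp
      have hij' := (hfix g).1 hρg
      rw [hτ, hτ] at hij'
      exact hζ.pow_inj (Finset.mem_range.1 hi) (Finset.mem_range.1 hj)
        ((algebraMap k' F').injective (mul_right_cancel₀ hg0 hij'))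
  rw [Finset.card_range] at hle
  omega

end IsCoordMap

section Affine

variable {k F : Type*} [Field k] [Field F] [Algebra k F] [IsAlgClosed k]

theorem coeff_eq_zero_of_affine {x : F} (hx : Transcendental k x) {a b : k}
    (h : algebraMap k F a * x + algebraMap k F b = 0) : a = 0 ∧ b = 0 := by
  by_cases ha : a = 0
  · rw [ha, map_zero, zero_mul, zero_add, map_eq_zero_iff _ (algebraMap k F).injective] at h
    exact ⟨ha, h⟩
  · exact absurd isAlgebraic_zero (h ▸ transcendental_affine hx ha b)

end Affine

namespace IsCoordMap

variable {k F k' F' : Type*} [Field k] [Field F] [Field k'] [Field F'] [Algebra k F] [Algebra k' F']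
  {e : (F ≃ₐ[k] F) ≃* (F' ≃ₐ[k'] F')} {α : k →+* k'} {φ : F → F'}

theorem apply_affine (h : IsCoordMap e α φ) (a b : k) (x : F) :
    φ (algebraMap k F a * x + algebraMap k F b) =
      algebraMap k' F' (α a) * φ x + algebraMap k' F' (α b) := by
  rw [h.translation, h.scaling]

variable [IsAlgClosed k] [IsAlgClosed k']

theorem coeff_eq_zero (h : IsCoordMap e α φ) {x y : F} (hx : Transcendental k x)
    (hxy : ∀ a b : k, y ≠ algebraMap k F a * x + algebraMap k F b) {a b c : k'}
    (h0 : algebraMap k' F' a * φ x + algebraMap k' F' b * φ y + algebraMap k' F' c = 0) :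
    a = 0 ∧ b = 0 ∧ c = 0 := by
  by_cases hb : b = 0
  · rw [hb, map_zero, zero_mul, add_zero] at h0
    obtain ⟨ha, hc⟩ := coeff_eq_zero_of_affine (h.transcendental_iff.2 hx) h0
    exact ⟨ha, hb, hc⟩
  · exfalso
    obtain ⟨r, hr⟩ := h.bijective_left.2 (-a / b)
    obtain ⟨s, hs⟩ := h.bijective_left.2 (-c / b)
    refine hxy r s (h.bijective.1 ?_)
    have hb' : algebraMap k' F' b ≠ 0 := (_root_.map_ne_zero _).2 hb
    rw [h.apply_affine, hr, hs, map_div₀, map_div₀, map_neg, map_neg]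
    field_simp
    linear_combination h0

variable [IsAlgClosed F] [TrdegOne k F] [IsAlgClosed F'] [TrdegOne k' F']

theorem exists_apply_add (h : IsCoordMap e α φ) {x y : F} (hx : Transcendental k x)
    (hy : Transcendental k y) (hxy : ∀ a b : k, y ≠ algebraMap k F a * x + algebraMap k F b) :
    ∃ a b : k', φ (x + y) = algebraMap k' F' a * φ x + algebraMap k' F' b * φ y := by
  have hx0 := ne_zero_of_transcendental hx
  have hy0 := ne_zero_of_transcendental hy
  have hr : Transcendental k (x / y) := by
    by_contra hn
    obtain ⟨c, hc⟩ := not_transcendental_iff.1 hn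
    refine hxy c⁻¹ 0 ?_
    rw [map_inv₀, hc, map_zero, add_zero, inv_div, div_mul_cancel₀ _ hx0]
  have hs : Transcendental k (x + y) := by
    by_contra hn
    obtain ⟨c, hc⟩ := not_transcendental_iff.1 hn
    refine hxy (-1) c ?_
    rw [hc, map_neg, map_one]
    ring
  have h1 : y * (x / y + algebraMap k F 1) = x + y := by
    rw [map_one]
    field_simp
  have h2 : y * (x / y) = x := mul_div_cancel₀ _ hy0
  obtain ⟨c, hc⟩ := h.apply_mul_of_transcendental hy (transcendental_add_right hr 1) (h1 ▸ hs)
  obtain ⟨d, hd⟩ := h.apply_mul_of_transcendental hy hr (by rwa [h2])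
  rw [h1, h.translation, map_one α, map_one (algebraMap k' F')] at hc
  rw [h2] at hd
  have hd0 : algebraMap k' F' d ≠ 0 := fun h0 => h.apply_ne_zero hx0 (by rw [hd, h0, zero_mul])
  refine ⟨c / d, c, ?_⟩
  rw [hc, hd, map_div₀]
  field_simp

theorem apply_add_of_transcendental (h : IsCoordMap e α φ) {x y : F} (hx : Transcendental k x)
    (hy : Transcendental k y) (hxy : ∀ a b : k, y ≠ algebraMap k F a * x + algebraMap k F b) :
    φ (x + y) = φ x + φ y := by
  obtain ⟨a, b, hab⟩ := h.exists_apply_add hx hy hxy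
  have hone : φ (x + y + algebraMap k F 1) = φ (x + y) + 1 := by
    rw [h.translation, map_one, map_one]
  obtain ⟨c, d, hcd⟩ := h.exists_apply_add (transcendental_add_right hx 1) hy fun r s hrs =>
    hxy r (r + s) (by rw [hrs, map_add, map_one]; ring)
  obtain ⟨c', d', hcd'⟩ := h.exists_apply_add hx (transcendental_add_right hy 1) fun r s hrs =>
    hxy r (s - 1) (by rw [map_sub, ← add_sub_assoc, ← hrs]; ring)
  rw [h.translation, map_one α, map_one (algebraMap k' F'), add_right_comm, hone, hab] at hcd
  rw [h.translation, map_one α, map_one (algebraMap k' F'), ← add_assoc, hone, hab] at hcd'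
  obtain ⟨h1, -, h2⟩ := h.coeff_eq_zero hx hxy (a := a - c) (b := b - d) (c := 1 - c) (by
    rw [map_sub, map_sub, map_sub, map_one]
    linear_combination hcd)
  obtain ⟨-, h3, h4⟩ := h.coeff_eq_zero hx hxy (a := a - c') (b := b - d') (c := 1 - d') (by
    rw [map_sub, map_sub, map_sub, map_one]
    linear_combination hcd')
  have ha : a = 1 := by linear_combination h1 - h2
  have hb : b = 1 := by linear_combination h3 - h4
  rw [hab, ha, hb, map_one, one_mul, one_mul]

theorem apply_add (h : IsCoordMap e α φ) (x y : F) : φ (x + y) = φ x + φ y := by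
  by_cases hy : Transcendental k y
  · by_cases hx : Transcendental k x
    · by_cases hxy : ∃ a b : k, y = algebraMap k F a * x + algebraMap k F b
      · obtain ⟨a, b, rfl⟩ := hxy
        have : x + (algebraMap k F a * x + algebraMap k F b) =
            algebraMap k F (1 + a) * x + algebraMap k F b := by
          rw [map_add, map_one]
          ring
        rw [this, h.apply_affine, h.apply_affine, map_add, map_add, map_one, map_one]
        ring
      · push Not at hxy
        exact h.apply_add_of_transcendental hx hy hxy
    · obtain ⟨a, rfl⟩ := not_transcendental_iff.1 hx
      rw [add_comm, h.translation, h.map_algebraMap, add_comm]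
  · obtain ⟨a, rfl⟩ := not_transcendental_iff.1 hy
    rw [h.translation, h.map_algebraMap]

theorem apply_mul_of_transcendental_mul (h : IsCoordMap e α φ) {x y : F}
    (hx : Transcendental k x) (hy : Transcendental k y) (hxy : Transcendental k (x * y)) :
    φ (x * y) = φ x * φ y := by
  obtain ⟨a, ha0, ha⟩ : ∃ a : k, a ≠ 0 ∧ Transcendental k (x * (y + algebraMap k F a)) := by
    classical
    by_contra! hn
    obtain ⟨b, hb⟩ := Infinite.exists_notMem_finset ({0, 1} : Finset k)
    rw [Finset.mem_insert, Finset.mem_singleton, not_or] at hb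
    have h1 := hn 1 one_ne_zero
    have h2 := hn b hb.1
    rw [transcendental_iff_notMem_bot, not_not] at h1 h2
    have h3 := sub_mem h1 h2
    have h4 : x * (y + algebraMap k F 1) - x * (y + algebraMap k F b) =
        algebraMap k F (1 - b) * x := by
      rw [map_sub]
      ring
    rw [h4] at h3
    exact transcendental_iff_notMem_bot.1
      (transcendental_mul_left hx (sub_ne_zero.2 (Ne.symm hb.2))) h3
  obtain ⟨c, hc⟩ := h.apply_mul_of_transcendental hx hy hxy
  obtain ⟨d, hd⟩ := h.apply_mul_of_transcendental hx (transcendental_add_right hy a) ha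
  have hsplit : x * (y + algebraMap k F a) = x * y + algebraMap k F a * x := by ring
  rw [hsplit, h.apply_add, h.scaling, h.translation, hc] at hd
  have hx0 := h.apply_ne_zero (ne_zero_of_transcendental hx)
  obtain ⟨h1, h2⟩ := coeff_eq_zero_of_affine (h.transcendental_iff.2 hy)
    (a := c - d) (b := α a - d * α a) (mul_left_cancel₀ hx0 (by
      rw [map_sub, map_sub, map_mul]
      linear_combination hd))
  have hα : α a ≠ 0 := (_root_.map_ne_zero α).2 ha0
  have hd1 : d = 1 := mul_right_cancel₀ hα (by linear_combination -h2)
  have hc1 : c = 1 := by linear_combination h1 + hd1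
  rw [hc, hc1, map_one, one_mul]

theorem apply_mul (h : IsCoordMap e α φ) (x y : F) : φ (x * y) = φ x * φ y := by
  by_cases hx : Transcendental k x
  · by_cases hy : Transcendental k y
    · by_cases hxy : Transcendental k (x * y)
      · exact h.apply_mul_of_transcendental_mul hx hy hxy
      · obtain ⟨c, hc⟩ := not_transcendental_iff.1 hxy
        have hx0 := ne_zero_of_transcendental hx
        have hy' : y = algebraMap k F c * x⁻¹ := by
          rw [hc]
          field_simp
        have hx2 : Transcendental k (x * x) := by
          rw [← sq]
          exact hx.pow two_pos
        have hxi : Transcendental k x⁻¹ := (IsGen.inv (L := k⟮x⟯) ⟨hx, rfl⟩).1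
        have h1 : x⁻¹ * (x * x) = x := inv_mul_cancel_left₀ hx0 x
        have h2 := h.apply_mul_of_transcendental_mul hxi hx2 (h1.symm ▸ hx)
        rw [h1, h.apply_mul_of_transcendental_mul hx hx hx2, ← mul_assoc] at h2
        have h3 : φ x⁻¹ * φ x = 1 := (mul_eq_right₀ (h.apply_ne_zero hx0)).1 h2.symm
        rw [← hc, hy', h.scaling, h.map_algebraMap, mul_left_comm, mul_comm (φ x), h3, mul_one]
    · obtain ⟨a, rfl⟩ := not_transcendental_iff.1 hy
      rw [mul_comm, h.scaling, h.map_algebraMap, mul_comm]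
  · obtain ⟨a, rfl⟩ := not_transcendental_iff.1 hx
    rw [h.scaling, h.map_algebraMap]

end IsCoordMap

section Reconstruction

variable {k F k' F' : Type*} [Field k] [Field F] [Field k'] [Field F'] [Algebra k F] [Algebra k' F']
  [IsAlgClosed k] [IsAlgClosed F] [IsAlgClosed k'] [IsAlgClosed F'] [TrdegOne k F] [TrdegOne k' F']

theorem exists_ringEquiv_of_hasFiniteOrbits {e : (F ≃ₐ[k] F) ≃* (F' ≃ₐ[k'] F')}
    (he : HasFiniteOrbits e) (he' : HasFiniteOrbits e.symm) :
    ∃ ψ : F ≃+* F', (∀ τ z, ψ (τ z) = e τ (ψ z)) ∧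
      ∀ z, ψ z ∈ Set.range (algebraMap k' F') ↔ z ∈ Set.range (algebraMap k F) := by
  obtain ⟨x, y, hxy⟩ := exists_isNormalizedPair he he'
  obtain ⟨α, φ, h⟩ := hxy.exists_isCoordMap
  refine ⟨{ Equiv.ofBijective φ h.bijective with
    map_mul' := h.apply_mul
    map_add' := h.apply_add }, h.equivariant, fun z => ?_⟩
  have := (h.transcendental_iff (x := z)).not
  rwa [not_transcendental_iff, not_transcendental_iff] at this

end Reconstruction

section Centralizer

variable {k F : Type*} [Field k] [Field F] [Algebra k F] [IsAlgClosed k] [IsAlgClosed F]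

theorem HasLevel.isGen {L : IntermediateField k F} {p : ℕ} [ExpChar F p] {σ : F ≃ₐ[k] F} {n : ℤ}
    {x : F} (hσ : HasLevel L p σ n) (hx : IsGen L x) : IsGen L (frobZ F p n (σ x)) := by
  refine hx.of_mem ((hσ x).1 hx.mem) ?_
  set y := frobZ F p n (σ x) with hy
  obtain ⟨M, hM⟩ := exists_forall_mem_iff_frobZ_mem p n k⟮y⟯
  have hr : σ.symm (frobZ F p (-n) x) ∈ L := by
    rw [hσ, AlgEquiv.apply_symm_apply, frobZ_frobZ_neg]
    exact hx.mem
  have hle : L ≤ M.comap (σ : F →ₐ[k] F) := by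
    rw [← hx.2, adjoin_simple_le_iff]
    exact (hM (σ x)).2 (mem_adjoin_simple_self k y)
  have h1 : σ (σ.symm (frobZ F p (-n) x)) ∈ M := hle hr
  rwa [AlgEquiv.apply_symm_apply, hM, frobZ_frobZ_neg] at h1

variable [TrdegOne k F]

theorem exists_frobZ_eq_of_commute (p : ℕ) [ExpChar F p] {δ : F ≃+* F}
    (hδ : ∀ (τ : F ≃ₐ[k] F) z, δ (τ z) = τ (δ z))
    (hk : ∀ z, δ z ∈ Set.range (algebraMap k F) ↔ z ∈ Set.range (algebraMap k F)) :
    ∃ n : ℤ, ∀ z, frobZ F p n (δ z) = z := by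
  classical
  obtain ⟨x, hx⟩ := TrdegOne.exists_transcendental (k := k) (F := F)
  have hgen : IsGen k⟮x⟯ x := ⟨hx, rfl⟩
  have hδx : Transcendental k (δ x) := by
    by_contra hn
    exact not_transcendental_iff.2 ((hk x).1 (not_transcendental_iff.1 hn)) hx
  obtain ⟨σ, hσ⟩ := exists_algEquiv_apply_eq hx hδx
  obtain ⟨n, hn⟩ := exists_hasLevel p hgen (σ := σ) fun τ => by
    rw [hσ, ← hδ, δ.injective.eq_iff]
  have hy := hn.isGen hgen
  rw [hσ] at hy
  have hcomm : ∀ (τ : F ≃ₐ[k] F) z, frobZ F p n (δ (τ z)) = τ (frobZ F p n (δ z)) := fun τ z => by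
    rw [hδ, frobZ_algEquiv]
  have hfix : frobZ F p n (δ x) = x := by
    obtain ⟨c, hc⟩ := Infinite.exists_notMem_finset ({0, 1} : Finset k)
    obtain ⟨hc0, hc1⟩ : c ≠ 0 ∧ c ≠ 1 := by simpa using hc
    obtain ⟨c', hc'⟩ : ∃ c', frobZ F p n (δ (algebraMap k F c)) = algebraMap k F c' := by
      obtain ⟨d, hd⟩ := (hk _).2 ⟨c, rfl⟩
      rw [← hd]
      exact exists_frobZ_algebraMap n d
    have hc'1 : c' ≠ 1 := by
      rintro rfl
      rw [map_one, map_eq_one_iff _ (frobZ F p n).injective, map_eq_one_iff _ δ.injective,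
        map_eq_one_iff _ (algebraMap k F).injective] at hc'
      exact hc1 hc'
    obtain ⟨τ, hτ⟩ := exists_algEquiv_apply_eq hx (transcendental_mul_left hx hc0)
    obtain ⟨ρ, hρ⟩ := exists_algEquiv_apply_eq hx (transcendental_add_right hx 1)
    have hτy : τ (frobZ F p n (δ x)) = algebraMap k F c' * frobZ F p n (δ x) := by
      rw [← hcomm, hτ, map_mul, map_mul, hc']
    have hρy : ρ (frobZ F p n (δ x)) = frobZ F p n (δ x) + 1 := by
      rw [← hcomm, hρ]
      simp only [map_add, map_one]
    obtain ⟨b, -, hb | hb⟩ := hgen.eq_or_eq_inv_of_scaling hy hc'1 hτ hτy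
    · rw [hb, map_mul, AlgEquiv.commutes, hρ, map_one, mul_add, mul_one, add_right_inj] at hρy
      rw [hb, hρy, one_mul]
    · exfalso
      have hx0 := ne_zero_of_transcendental hx
      have hx1 := ne_zero_of_transcendental (transcendental_add_right hx 1)
      rw [hb, map_mul, AlgEquiv.commutes, map_inv₀, hρ] at hρy
      rw [map_one] at hρy hx1
      field_simp at hρy
      refine one_ne_zero (coeff_eq_zero_of_quadratic hx (a := 1) (b := 1) (c := b) ?_).1
      rw [map_one]
      linear_combination -hρy
  have hall : ∀ z, Transcendental k z → frobZ F p n (δ z) = z := fun z hz => by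
    obtain ⟨τ, rfl⟩ := exists_algEquiv_apply_eq hx hz
    rw [hcomm, hfix]
  refine ⟨n, fun z => ?_⟩
  by_cases hz : Transcendental k z
  · exact hall z hz
  · obtain ⟨a, rfl⟩ := not_transcendental_iff.1 hz
    have h1 := hall _ (transcendental_add_right hx a)
    rwa [map_add, map_add, hfix, add_right_inj] at h1

theorem eq_self_of_commute {δ : F ≃+* F} (hδ : ∀ (τ : F ≃ₐ[k] F) z, δ (τ z) = τ (δ z))
    (hk : ∀ z, δ z ∈ Set.range (algebraMap k F) ↔ z ∈ Set.range (algebraMap k F))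
    {K : IntermediateField k F} (hfg : K.FG) (hKt : ∃ x ∈ K, Transcendental k x)
    (hK : ∀ z, δ z ∈ K ↔ z ∈ K) (z : F) : δ z = z := by
  obtain ⟨p, hp⟩ := ExpChar.exists F
  obtain ⟨n, hn⟩ := exists_frobZ_eq_of_commute p hδ hk
  rcases expChar_is_prime_or_one F p with hpp | rfl
  · suffices n = 0 by
      have h := hn z
      rwa [this, frobZ_zero] at h
    obtain ⟨x, hxK, hx⟩ := hKt
    obtain ⟨N, hN⟩ := exists_forall_pow_ne hpp hfg hx
    have hmem : ∀ z, frobZ F p n z ∈ K ↔ z ∈ K := fun z => by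
      obtain ⟨w, rfl⟩ := δ.surjective z
      rw [hn, hK]
    by_contra hn0
    obtain ⟨m, hm, hroot⟩ : ∃ m : ℕ, 0 < m ∧ ∀ z ∈ K, frobZ F p (-m) z ∈ K := by
      obtain ⟨m, rfl | rfl⟩ := n.eq_nat_or_neg
      · exact ⟨m, by omega, fun z hz => by rwa [← hmem, frobZ_frobZ_neg]⟩
      · exact ⟨m, by omega, fun z hz => (hmem z).2 hz⟩
    have hiter : ∀ j : ℕ, frobZ F p (-(m * j : ℕ)) x ∈ K := fun j => by
      induction j with
      | zero => simpa [frobZ_zero] using hxK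
      | succ j ih =>
        have : (-((m * (j + 1) : ℕ) : ℤ)) = -m + -((m * j : ℕ) : ℤ) := by
          push_cast
          ring
        rw [this, frobZ_add]
        exact hroot _ ih
    have hle : N ≤ m * N := Nat.le_mul_of_pos_left N hm
    refine hN _ (pow_mem (hiter N) (p ^ (m * N - N))) ?_
    rw [← pow_mul, ← pow_add, Nat.sub_add_cancel hle, ← frobZ_natCast, frobZ_frobZ_neg]
  · rw [← frobZ_one_left n (δ z), hn]

end Centralizer

section Transport

variable {k F k' F' : Type*} [Field k] [Field F] [Field k'] [Field F'] [Algebra k F] [Algebra k' F']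

theorem exists_fg_forall_mem_iff_apply_mem (ψ : F ≃+* F')
    (h : ∀ z, ψ z ∈ Set.range (algebraMap k' F') ↔ z ∈ Set.range (algebraMap k F))
    {K' : IntermediateField k' F'} (hK' : K'.FG) :
    ∃ L : IntermediateField k F, L.FG ∧ ∀ z, z ∈ L ↔ ψ z ∈ K' := by
  classical
  obtain ⟨S, rfl⟩ := hK'
  obtain ⟨M, hM⟩ := exists_forall_mem_iff_apply_mem (ψ : F →+* F')
    (fun a => (h _).2 ⟨a, rfl⟩) (adjoin k' (S : Set F'))
  obtain ⟨M', hM'⟩ := exists_forall_mem_iff_apply_mem (k := k') (k' := k) (ψ.symm : F' →+* F)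
    (fun a => (h _).1 ⟨a, (ψ.apply_symm_apply _).symm⟩)
    (adjoin k (S.image ψ.symm : Set F))
  have hle : adjoin k' (S : Set F') ≤ M' := adjoin_le_iff.2 fun s hs =>
    (hM' s).2 (subset_adjoin k _ (Finset.mem_coe.2 (Finset.mem_image_of_mem _ hs)))
  refine ⟨adjoin k (S.image ψ.symm : Set F), ⟨_, rfl⟩, fun z => ⟨fun hz => ?_, fun hz => ?_⟩⟩
  · refine (hM z).1 ((adjoin_le_iff (T := M)).2 (fun s hs => (hM s).2 ?_) hz)
    obtain ⟨t, ht, rfl⟩ := Finset.mem_image.1 (Finset.mem_coe.1 hs)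
    exact subset_adjoin k' _ (by simpa using ht)
  · simpa using (hM' _).1 (hle hz)

theorem RingEquiv.image_eq_iff_forall_mem (σ : F' ≃+* F) {A : Set F'} {B : Set F} :
    σ '' A = B ↔ ∀ z, σ.symm z ∈ A ↔ z ∈ B := by
  rw [σ.image_eq_preimage_symm, Set.ext_iff]
  rfl

/-- Conjugation by a field isomorphism compatible with the base fields. -/
def conjAutEquiv (σ : F' ≃+* F)
    (h : σ '' Set.range (algebraMap k' F') = Set.range (algebraMap k F)) :
    (F ≃ₐ[k] F) ≃* (F' ≃ₐ[k'] F') where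
  toFun τ := AlgEquiv.ofRingEquiv (f := (σ.trans τ.toRingEquiv).trans σ.symm) fun a => by
    obtain ⟨b, hb⟩ : σ (algebraMap k' F' a) ∈ Set.range (algebraMap k F) :=
      h ▸ Set.mem_image_of_mem σ ⟨a, rfl⟩
    change σ.symm (τ (σ _)) = _
    rw [← hb, AlgEquiv.commutes, hb, σ.symm_apply_apply]
  invFun τ := AlgEquiv.ofRingEquiv (f := (σ.symm.trans τ.toRingEquiv).trans σ) fun a => by
    obtain ⟨b, hb⟩ := (σ.image_eq_iff_forall_mem.1 h (algebraMap k F a)).2 ⟨a, rfl⟩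
    change σ (τ (σ.symm _)) = _
    rw [← hb, AlgEquiv.commutes, hb, σ.apply_symm_apply]
  left_inv τ := AlgEquiv.ext fun x => by
    change σ (σ.symm (τ (σ (σ.symm x)))) = τ x
    rw [σ.apply_symm_apply, σ.apply_symm_apply]
  right_inv τ := AlgEquiv.ext fun x => by
    change σ.symm (σ (τ (σ.symm (σ x)))) = τ x
    rw [σ.symm_apply_apply, σ.symm_apply_apply]
  map_mul' τ ρ := AlgEquiv.ext fun x => by
    change σ.symm (τ (ρ (σ x))) = σ.symm (τ (σ (σ.symm (ρ (σ x)))))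
    rw [σ.apply_symm_apply]

theorem continuous_autTop_of_apply {e : (F ≃ₐ[k] F) → (F' ≃ₐ[k'] F')} (f : F → F') (g : F' → F)
    (h : ∀ τ x, e τ x = f (τ (g x))) : @Continuous _ _ (autTop k F) (autTop k' F') e := by
  let _ : TopologicalSpace F := ⊥
  let _ : TopologicalSpace F' := ⊥
  have : DiscreteTopology F := ⟨rfl⟩
  let _ : TopologicalSpace (F ≃ₐ[k] F) := autTop k F
  refine continuous_induced_rng.2 (continuous_pi fun x => ?_)
  have h1 : Continuous fun τ : F ≃ₐ[k] F => τ (g x) :=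
    (continuous_apply (g x)).comp continuous_induced_dom
  exact (continuous_of_discreteTopology.comp h1 : Continuous fun τ : F ≃ₐ[k] F => f (τ (g x))).congr
    fun τ => (h τ x).symm

theorem map_conjAutEquiv_fixingSubgroup {K : IntermediateField k F} {K' : IntermediateField k' F'}
    (σ : F' ≃+* F) (h : σ '' Set.range (algebraMap k' F') = Set.range (algebraMap k F))
    (hK : σ '' (K' : Set F') = K) :
    K.fixingSubgroup.map (conjAutEquiv σ h).toMonoidHom = K'.fixingSubgroup := by
  ext τ
  rw [Subgroup.mem_map_equiv, IntermediateField.mem_fixingSubgroup_iff,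
    IntermediateField.mem_fixingSubgroup_iff]
  rw [σ.image_eq_iff_forall_mem] at hK
  constructor
  · intro h x hx
    have := h (σ x) ((hK _).1 (by rwa [σ.symm_apply_apply]))
    change σ (τ (σ.symm (σ x))) = σ x at this
    rw [σ.symm_apply_apply] at this
    exact σ.injective this
  · intro h x hx
    have := h (σ.symm x) ((hK x).2 hx)
    change σ (τ (σ.symm x)) = x
    rw [this, σ.apply_symm_apply]

variable [IsAlgClosed k]

theorem transcendental_apply_iff [IsAlgClosed k'] (ψ : F ≃+* F')
    (h : ∀ z, ψ z ∈ Set.range (algebraMap k' F') ↔ z ∈ Set.range (algebraMap k F)) {x : F} :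
    Transcendental k' (ψ x) ↔ Transcendental k x := by
  rw [← not_iff_not, not_transcendental_iff, not_transcendental_iff]
  exact h x

variable [IsAlgClosed F] [TrdegOne k F]

theorem exists_ringEquiv_of_continuous [IsAlgClosed k'] [IsAlgClosed F'] [TrdegOne k' F']
    {K : IntermediateField k F} {K' : IntermediateField k' F'} (hfg : K.FG) (hfg' : K'.FG)
    (hKt : ∃ x ∈ K, Transcendental k x) (hKt' : ∃ x ∈ K', Transcendental k' x)
    {e : (F ≃ₐ[k] F) ≃* (F' ≃ₐ[k'] F')} (he : @Continuous _ _ (autTop k F) (autTop k' F') e)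
    (he' : @Continuous _ _ (autTop k' F') (autTop k F) e.symm)
    (hK : K.fixingSubgroup.map e.toMonoidHom = K'.fixingSubgroup) :
    ∃ ψ : F ≃+* F', (∀ τ z, ψ (τ z) = e τ (ψ z)) ∧
      (∀ z, ψ z ∈ Set.range (algebraMap k' F') ↔ z ∈ Set.range (algebraMap k F)) ∧
      ∀ z, ψ z ∈ K' ↔ z ∈ K := by
  obtain ⟨ψ, hψ, hk⟩ := exists_ringEquiv_of_hasFiniteOrbits
    (hasFiniteOrbits_of_continuous he) (hasFiniteOrbits_of_continuous he')
  obtain ⟨p, hp⟩ := ExpChar.exists F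
  obtain ⟨L, hL, hmem⟩ := exists_fg_forall_mem_iff_apply_mem ψ hk hfg'
  have hstab : ∀ τ : F ≃ₐ[k] F, (∀ z ∈ K, τ z = z) ↔ ∀ z ∈ L, τ z = z := fun τ => by
    have h1 : (∀ z ∈ K, τ z = z) ↔ e τ ∈ K'.fixingSubgroup := by
      rw [← hK, Subgroup.mem_map_equiv, MulEquiv.symm_apply_apply,
        IntermediateField.mem_fixingSubgroup_iff]
    rw [h1, IntermediateField.mem_fixingSubgroup_iff]
    constructor
    · intro h z hz
      refine ψ.injective ?_
      rw [hψ]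
      exact h _ ((hmem z).1 hz)
    · intro h z hz
      obtain ⟨w, rfl⟩ := ψ.surjective z
      rw [← hψ, h w ((hmem w).2 hz)]
  obtain ⟨x', hx', hxt'⟩ := hKt'
  obtain ⟨n, hn⟩ := exists_frobZ_mem_iff p hfg hL hKt
    ⟨ψ.symm x', (hmem _).2 (by rwa [ψ.apply_symm_apply]),
      (transcendental_apply_iff ψ hk).1 (by rwa [ψ.apply_symm_apply])⟩ hstab
  refine ⟨(frobZ F p n).trans ψ, fun τ z => ?_, fun z => ?_, fun z => ?_⟩
  · rw [RingEquiv.trans_apply, RingEquiv.trans_apply, ← hψ, frobZ_algEquiv]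
  · rw [RingEquiv.trans_apply, hk]
    constructor
    · rintro ⟨a, ha⟩
      obtain ⟨b, hb⟩ := exists_frobZ_algebraMap (p := p) (F := F) (-n) a
      rw [ha, frobZ_neg_frobZ] at hb
      exact ⟨b, hb.symm⟩
    · rintro ⟨a, rfl⟩
      obtain ⟨b, hb⟩ := exists_frobZ_algebraMap (p := p) (F := F) n a
      exact ⟨b, hb.symm⟩
  · rw [RingEquiv.trans_apply, hn, hmem]

theorem eq_of_conj_eq {K : IntermediateField k F} {K' : IntermediateField k' F'}
    (hfg : K.FG) (hKt : ∃ x ∈ K, Transcendental k x) {σ ρ : F' ≃+* F}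
    (hσ : σ '' Set.range (algebraMap k' F') = Set.range (algebraMap k F))
    (hρ : ρ '' Set.range (algebraMap k' F') = Set.range (algebraMap k F))
    (hσK : σ '' (K' : Set F') = K) (hρK : ρ '' (K' : Set F') = K)
    (h : ∀ (τ : F ≃ₐ[k] F) x, σ.symm (τ (σ x)) = ρ.symm (τ (ρ x))) : σ = ρ := by
  have hiff : ∀ {A : Set F'} {B : Set F}, σ '' A = B → ρ '' A = B →
      ∀ z, (σ.symm.trans ρ) z ∈ B ↔ z ∈ B := fun hσ hρ z => by
    rw [← ρ.image_eq_iff_forall_mem.1 hρ, RingEquiv.trans_apply, ρ.symm_apply_apply]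
    exact σ.image_eq_iff_forall_mem.1 hσ z
  have key := eq_self_of_commute (δ := σ.symm.trans ρ) (fun τ z => ?_) (hiff hσ hρ) hfg hKt
    (hiff hσK hρK)
  · refine RingEquiv.ext fun x => ?_
    have := key (σ x)
    rwa [RingEquiv.trans_apply, σ.symm_apply_apply, eq_comm] at this
  · have := h τ (σ.symm z)
    rw [σ.apply_symm_apply] at this
    rw [RingEquiv.trans_apply, RingEquiv.trans_apply, this, ρ.apply_symm_apply]

end Transport

/-- **Theorem A.** Let `K|k` and `K'|k'` be 1-dimensional function fields
over algebraically closed fields, with algebraic closures `F`, `F'`.  The map `Φ` sending a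
tower isomorphism `σ : F'|K'|k' ≅ F|K|k` to `Φ(σ) : (G_{F|k},U_K) ≅ (G_{F'|k'},U_{K'})`,
`Φ(σ)(τ) = σ⁻¹ ∘ τ ∘ σ`, is a bijection.  (Formulated via the graph relation
`R σ e ↔ ∀ τ x, e τ x = σ⁻¹(τ(σ x))`: every `σ` corresponds to a unique `e` and every `e`
to a unique `σ`.) -/
theorem stmt0 {k F k' F' : Type*} [Field k] [Field F] [Field k'] [Field F']
    [Algebra k F] [Algebra k' F'] [IsAlgClosed k] [IsAlgClosed k']
    [IsAlgClosed F] [IsAlgClosed F']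
    (K : IntermediateField k F) (K' : IntermediateField k' F')
    [Algebra.IsAlgebraic K F] [Algebra.IsAlgebraic K' F']
    (hfg : K.FG) (hfg' : K'.FG)
    (htr : ∃ x ∈ K, Transcendental k x ∧
      Algebra.IsAlgebraic (IntermediateField.adjoin k {x}) F)
    (htr' : ∃ x ∈ K', Transcendental k' x ∧
      Algebra.IsAlgebraic (IntermediateField.adjoin k' {x}) F') :
    (∀ σ : TowerIso k F k' F' K K', ∃! e : PairIso k F k' F' K K',
      ∀ (τ : F ≃ₐ[k] F) (x : F'), e.1 τ x = σ.1.symm (τ (σ.1 x))) ∧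
    (∀ e : PairIso k F k' F' K K', ∃! σ : TowerIso k F k' F' K K',
      ∀ (τ : F ≃ₐ[k] F) (x : F'), e.1 τ x = σ.1.symm (τ (σ.1 x))) := by
  obtain ⟨x, hxK, hx, hxF⟩ := htr
  obtain ⟨x', hxK', hx', hxF'⟩ := htr'
  have := TrdegOne.of_isAlgebraic hx hxF
  have := TrdegOne.of_isAlgebraic hx' hxF'
  refine ⟨?_, ?_⟩
  · rintro ⟨σ, hσ, hσK⟩
    refine ⟨⟨conjAutEquiv σ hσ, continuous_autTop_of_apply σ.symm σ fun _ _ => rfl,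
      continuous_autTop_of_apply σ σ.symm fun _ _ => rfl,
      map_conjAutEquiv_fixingSubgroup σ hσ hσK⟩, fun _ _ => rfl, fun e he => ?_⟩
    exact Subtype.ext (MulEquiv.ext fun τ => AlgEquiv.ext fun z => he τ z)
  · rintro ⟨e, he, he', heK⟩
    obtain ⟨ψ, hψ, hk, hK⟩ :=
      exists_ringEquiv_of_continuous hfg hfg' ⟨x, hxK, hx⟩ ⟨x', hxK', hx'⟩ he he' heK
    refine ⟨⟨ψ.symm, ψ.symm.image_eq_iff_forall_mem.2 hk, ψ.symm.image_eq_iff_forall_mem.2 hK⟩,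
      fun τ z => ?_, fun ρ hρ => ?_⟩
    · change e τ z = ψ (τ (ψ.symm z))
      rw [hψ, ψ.apply_symm_apply]
    · refine Subtype.ext (eq_of_conj_eq hfg ⟨x, hxK, hx⟩ ρ.2.1
        (ψ.symm.image_eq_iff_forall_mem.2 hk) ρ.2.2 (ψ.symm.image_eq_iff_forall_mem.2 hK)
        fun τ z => (hρ τ z).symm.trans ?_)
      change e τ z = ψ (τ (ψ.symm z))
      rw [hψ, ψ.apply_symm_apply]
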